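/- Let Ω ⊆ ℝ^N be a bounded open set. For each n let (y_n, D_n, f_n) be an admissible deformation triple on Ω (in particular y_n is injective on D_n, det(f_n x) > 0 on D_n, and det(f_n ·) is integrable) such that x ↦ cof(f_n x) is integrable on Ω. Let (y, D, f) be an a.e. approximately differentiable triple on Ω (no injectivity assumed) with x ↦ cof(f x) integrable on Ω, and let h ∈ L¹(Ω) with h > 0 a.e. Assume: y_n → y almost everywhere in Ω; cof(f_n ·) converges weakly in L¹(Ω; ℝ^{N×N}) to cof(f ·) (entrywise, tested against bounded measurable functions); det(f_n ·) converges weakly in L¹(Ω) to h; and sup_n 𝒮(y_n) < +∞. Then: h(x) = det(f x) for almost every x ∈ Ω; y is almost everywhere injective, i.e. there exists a Lebesgue-null set Z ⊆ Ω such that y is injective on Ω \ Z (so (y, D ∩ (Ω \ Z), f) is an admissible deformation triple); and 𝒮(y) ≤ liminf_{n→∞} 𝒮(y_n). -/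

import Mathlib

open MeasureTheory Filter Topology Set
open scoped ENNReal NNReal

noncomputable section

abbrev Euc (N : ℕ) := EuclideanSpace ℝ (Fin N)

/-- An a.e. approximately differentiable map on `A`, encoded as a triple `(u, D, f)`. -/
def ApproxDiffTriple {N : ℕ} (A D : Set (Euc N)) (u : Euc N → Euc N)
    (f : Euc N → Euc N →L[ℝ] Euc N) : Prop :=
  MeasurableSet D ∧ D ⊆ A ∧ volume (A \ D) = 0 ∧ ∀ x ∈ D, HasFDerivWithinAt u (f x) D x

/-- An admissible deformation on `Ω` (the class `𝒴(Ω)` of the paper). -/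
def AdmissibleDef {N : ℕ} (Ω D : Set (Euc N)) (y : Euc N → Euc N)
    (f : Euc N → Euc N →L[ℝ] Euc N) : Prop :=
  ApproxDiffTriple Ω D y f ∧ Set.InjOn y D ∧ (∀ x ∈ D, 0 < (f x).det) ∧
    IntegrableOn (fun x => (f x).det) Ω volume

/-- Weak convergence in `L¹(Ω)`, tested against bounded measurable functions. -/
def WeakL1ConvOn {N : ℕ} (Ω : Set (Euc N)) (u : ℕ → Euc N → ℝ) (v : Euc N → ℝ) : Prop :=
  ∀ g : Euc N → ℝ, Measurable g → (∃ C : ℝ, ∀ x, |g x| ≤ C) →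
    Tendsto (fun n => ∫ x in Ω, u n x * g x) atTop (𝓝 (∫ x in Ω, v x * g x))

/-- The matrix of a continuous linear endomorphism of `ℝ^N` in the standard basis. -/
def clmMatrix {N : ℕ} (T : Euc N →L[ℝ] Euc N) : Matrix (Fin N) (Fin N) ℝ :=
  LinearMap.toMatrix (EuclideanSpace.basisFun (Fin N) ℝ).toBasis
    (EuclideanSpace.basisFun (Fin N) ℝ).toBasis T.toLinearMap

/-- The cofactor matrix `cof M = (adjugate M)ᵀ` of a continuous linear endomorphism. -/
def cofCLM {N : ℕ} (T : Euc N →L[ℝ] Euc N) : Matrix (Fin N) (Fin N) ℝ :=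
  (clmMatrix T).adjugate.transpose

/-- Frobenius inner product of matrices. -/
def frobInner {N : ℕ} (A B : Matrix (Fin N) (Fin N) ℝ) : ℝ :=
  ∑ i, ∑ j, A i j * B i j

/-- Matrix of partial derivatives of `η` in the first (Lagrangian) variable. -/
def DxMatrix {N : ℕ} (η : Euc N × Euc N → Euc N) (x ξ : Euc N) :
    Matrix (Fin N) (Fin N) ℝ :=
  clmMatrix (fderiv ℝ (fun x' => η (x', ξ)) x)

/-- Divergence of `η` in the second (Eulerian) variable. -/
def divXi {N : ℕ} (η : Euc N × Euc N → Euc N) (x ξ : Euc N) : ℝ :=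
  LinearMap.trace ℝ (Euc N) (fderiv ℝ (fun ξ' => η (x, ξ')) ξ).toLinearMap

/-- The functional `𝒮_y(η)` of the paper. -/
def SEta {N : ℕ} (Ω : Set (Euc N)) (y : Euc N → Euc N)
    (f : Euc N → Euc N →L[ℝ] Euc N) (η : Euc N × Euc N → Euc N) : ℝ :=
  ∫ x in Ω, (frobInner (cofCLM (f x)) (DxMatrix η x (y x)) + divXi η x (y x) * (f x).det)

/-- Admissible test functions: smooth, compactly supported in `Ω × ℝ^N`,
with sup-norm at most `1`. -/
def TestFun {N : ℕ} (Ω : Set (Euc N)) (η : Euc N × Euc N → Euc N) : Prop :=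
  ContDiff ℝ (⊤ : ℕ∞) η ∧ HasCompactSupport η ∧
    tsupport η ⊆ Ω ×ˢ (Set.univ : Set (Euc N)) ∧ ∀ p, ‖η p‖ ≤ 1

/-- The surface energy `𝒮(y) = sup { 𝒮_y(η) : η admissible }`, valued in `[0, +∞]`. -/
def surfaceEnergy {N : ℕ} (Ω : Set (Euc N)) (y : Euc N → Euc N)
    (f : Euc N → Euc N →L[ℝ] Euc N) : ℝ≥0∞ :=
  ⨆ η : { η : Euc N × Euc N → Euc N // TestFun Ω η }, ENNReal.ofReal (SEta Ω y f η.1)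

/-! ### Weak convergence in `L¹` -/

section WeakConvergence

variable {α : Type*} [MeasurableSpace α] {μ : Measure α}

/-- Integration against a fixed integrable function is continuous on the unit ball of `L^∞`
equipped with the `L¹` distance. -/
theorem continuous_integral_mul_Lp_one {w : α → ℝ} (hw : Integrable w μ) :
    Continuous (fun p : {p : Lp ℝ 1 μ // ∀ᵐ x ∂μ, |(p : α → ℝ) x| ≤ 1} =>
      ∫ x, w x * (p.1 : α → ℝ) x ∂μ) := by
  rw [continuous_iff_seqContinuous]
  intro p q hpq
  refine tendsto_of_subseq_tendsto fun ns hns => ?_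
  have h1 : Tendsto (fun n => (p (ns n)).1) atTop (𝓝 q.1) :=
    ((continuous_subtype_val.tendsto q).comp hpq).comp hns
  obtain ⟨ms, hms, hae⟩ := (tendstoInMeasure_of_tendsto_Lp h1).exists_seq_tendsto_ae
  refine ⟨ms, ?_⟩
  refine tendsto_integral_of_dominated_convergence (fun x => |w x|) (fun n => ?_) hw.abs
    (fun n => ?_) ?_
  · exact hw.1.mul (Lp.aestronglyMeasurable _)
  · filter_upwards [(p (ns (ms n))).2] with x hx
    rw [Real.norm_eq_abs, abs_mul]
    exact mul_le_of_le_one_right (abs_nonneg _) hx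
  · filter_upwards [hae] with x hx
    exact hx.const_mul _

theorem isClosed_setOf_ae_abs_le_one :
    IsClosed {p : Lp ℝ 1 μ | ∀ᵐ x ∂μ, |(p : α → ℝ) x| ≤ 1} := by
  refine IsSeqClosed.isClosed fun p q hp hpq => ?_
  obtain ⟨ms, hms, hae⟩ := (tendstoInMeasure_of_tendsto_Lp hpq).exists_seq_tendsto_ae
  have : ∀ᵐ x ∂μ, ∀ n, |(p n : α → ℝ) x| ≤ 1 := ae_all_iff.2 hp
  filter_upwards [hae, this] with x hx h'
  exact le_of_tendsto hx.abs (Eventually.of_forall fun n => h' _)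

variable [IsFiniteMeasure μ]

/-- A weakly convergent sequence in `L¹` is asymptotically equi-integrable
(a form of the Vitali–Hahn–Saks theorem). -/
theorem exists_forall_setIntegral_abs_le_of_weak {w : ℕ → α → ℝ} {w₀ : α → ℝ}
    (hw : ∀ n, Integrable (w n) μ)
    (hlim : ∀ g : α → ℝ, Measurable g → (∃ C : ℝ, ∀ x, |g x| ≤ C) →
      Tendsto (fun n => ∫ x, w n x * g x ∂μ) atTop (𝓝 (∫ x, w₀ x * g x ∂μ)))
    {ε : ℝ} (hε : 0 < ε) :
    ∃ δ > 0, ∃ k : ℕ, ∀ n ≥ k, ∀ E, MeasurableSet E → μ.real E < δ →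
      ∫ x in E, |w n x| ∂μ ≤ ε := by
  set X := {p : Lp ℝ 1 μ // ∀ᵐ x ∂μ, |(p : α → ℝ) x| ≤ 1}
  have hXc : IsClosed {p : Lp ℝ 1 μ | ∀ᵐ x ∂μ, |(p : α → ℝ) x| ≤ 1} :=
    isClosed_setOf_ae_abs_le_one
  have : CompleteSpace X := hXc.completeSpace_coe
  have : Nonempty X := ⟨⟨0, by
    filter_upwards [Lp.coeFn_zero ℝ 1 μ] with x hx
    rw [hx]
    simp⟩⟩
  let I : ℕ → X → ℝ := fun n p => ∫ x, w n x * (p.1 : α → ℝ) x ∂μ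
  have hI : ∀ n, Continuous (I n) := fun n => continuous_integral_mul_Lp_one (hw n)
  let F : ℕ → Set X := fun k => ⋂ n ∈ Ici k, {p | |I n p - I k p| ≤ ε / 4}
  have hF : ∀ k, IsClosed (F k) := fun k => isClosed_biInter fun n _ =>
    isClosed_le ((hI n).sub (hI k)).abs continuous_const
  have hU : ⋃ k, F k = univ := by
    refine eq_univ_of_forall fun p => ?_
    obtain ⟨g, hgm, hgb, hge⟩ : ∃ g : α → ℝ, Measurable g ∧ (∃ C : ℝ, ∀ x, |g x| ≤ C) ∧
        (p.1 : α → ℝ) =ᵐ[μ] g := by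
      have hm := (Lp.stronglyMeasurable p.1).measurable
      refine ⟨fun x => max (-1) (min 1 ((p.1 : α → ℝ) x)), by fun_prop, ⟨1, fun x => ?_⟩, ?_⟩
      · rw [abs_le]
        exact ⟨le_max_left _ _, max_le (by norm_num) (min_le_left _ _)⟩
      · filter_upwards [p.2] with x hx
        rw [abs_le] at hx
        rw [min_eq_right hx.2, max_eq_right hx.1]
    have h1 := hlim g hgm hgb
    have h2 : ∀ n, ∫ x, w n x * g x ∂μ = I n p := fun n =>
      integral_congr_ae (by filter_upwards [hge] with x hx; rw [hx])
    simp only [h2] at h1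
    obtain ⟨k, hk⟩ := Metric.cauchySeq_iff'.1 h1.cauchySeq (ε / 4) (by positivity)
    refine mem_iUnion.2 ⟨k, mem_iInter₂.2 fun n hn => ?_⟩
    exact (hk n hn).le
  obtain ⟨k, p, hp⟩ := nonempty_interior_of_iUnion_of_closed hF hU
  obtain ⟨δ₁, hδ₁, hball⟩ := Metric.isOpen_iff.1 isOpen_interior p hp
  obtain ⟨δ₂, hδ₂, hk⟩ : ∃ δ₂ > 0, ∀ E, MeasurableSet E → μ.real E < δ₂ →
      ∫ x in E, |w k x| ∂μ ≤ ε / 2 := by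
    have hi := (memLp_one_iff_integrable.2 (hw k)).eLpNorm_indicator_le le_rfl (by simp)
      (ε := ε / 2) (by positivity)
    obtain ⟨δ, hδ, h⟩ := hi
    refine ⟨δ, hδ, fun E hE hEδ => ?_⟩
    have h1 := h E hE (by
      rw [← ofReal_measureReal (measure_ne_top μ E)]
      exact ENNReal.ofReal_le_ofReal hEδ.le)
    rw [eLpNorm_one_eq_lintegral_enorm] at h1
    have h2 : ∫ x in E, |w k x| ∂μ = ∫ x, ‖E.indicator (w k) x‖ ∂μ := by
      rw [← integral_indicator hE]
      congr 1 with x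
      by_cases hx : x ∈ E <;> simp [hx]
    rw [h2, integral_norm_eq_lintegral_enorm ((hw k).indicator hE).1]
    exact ENNReal.toReal_le_of_le_ofReal (by positivity) h1
  refine ⟨min (δ₁ / 2) δ₂, lt_min (by positivity) hδ₂, k, fun n hn E hE hEδ => ?_⟩
  have hE₁ := hEδ.trans_le (min_le_left _ _)
  have hE₂ := hEδ.trans_le (min_le_right _ _)
  have hEk := hk E hE hE₂
  have hpm := (Lp.stronglyMeasurable p.1).measurable
  have hwint : ∀ n (v : α → ℝ), Measurable v → (∀ᵐ x ∂μ, |v x| ≤ 1) →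
      Integrable (fun x => w n x * v x) μ := fun n v hv hv1 =>
    (hw n).mul_bdd (c := 1) hv.aestronglyMeasurable (by simpa using hv1)
  -- perturbations of `p` on `E` stay in the ball
  have key : ∀ s : α → ℝ, Measurable s → (∀ x, |s x| ≤ 1) →
      |∫ x, (w n x - w k x) * (E.indicator s x + Eᶜ.indicator (p.1 : α → ℝ) x) ∂μ| ≤ ε / 4 := by
    intro s hs hs1
    set v : α → ℝ := fun x => E.indicator s x + Eᶜ.indicator (p.1 : α → ℝ) x with hv
    have hvm : Measurable v := (hs.indicator hE).add (hpm.indicator hE.compl)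
    have hv1 : ∀ᵐ x ∂μ, |v x| ≤ 1 := by
      filter_upwards [p.2] with x hx
      by_cases hxE : x ∈ E
      · simpa [hv, hxE] using hs1 x
      · simpa [hv, hxE] using hx
    have hvL : MemLp v 1 μ := MemLp.of_bound hvm.aestronglyMeasurable 1 (by simpa using hv1)
    let q : X := ⟨hvL.toLp v, by
      filter_upwards [hvL.coeFn_toLp, hv1] with x hx hx1
      rwa [hx]⟩
    have hq : q ∈ Metric.ball p δ₁ := by
      rw [Metric.mem_ball, Subtype.dist_eq, dist_eq_norm, L1.norm_eq_integral_norm]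
      have h1 : ∫ x, ‖((q.1 - p.1 : Lp ℝ 1 μ) : α → ℝ) x‖ ∂μ ≤
          ∫ x, E.indicator (fun _ => (2 : ℝ)) x ∂μ := by
        refine integral_mono_ae (L1.integrable_coeFn _).norm
          ((integrable_const _).indicator hE) ?_
        filter_upwards [Lp.coeFn_sub q.1 p.1, hvL.coeFn_toLp, p.2] with x h1 h2 h3
        change ‖((q.1 - p.1 : Lp ℝ 1 μ) : α → ℝ) x‖ ≤ _
        rw [h1, Pi.sub_apply, h2]
        by_cases hxE : x ∈ E
        · simp only [hv, hxE, indicator_of_mem, mem_compl_iff, not_true_eq_false,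
            not_false_eq_true, indicator_of_notMem, add_zero, Real.norm_eq_abs]
          calc |s x - (p.1 : α → ℝ) x| ≤ |s x| + |(p.1 : α → ℝ) x| := abs_sub _ _
            _ ≤ 2 := by linarith [hs1 x]
        · simp [hv, hxE]
      refine h1.trans_lt ?_
      rw [integral_indicator_const _ hE, smul_eq_mul]
      linarith
    have h2 := mem_iInter₂.1 (interior_subset (hball hq)) n hn
    have h3 : ∀ n, I n q = ∫ x, w n x * v x ∂μ := fun n =>
      integral_congr_ae (by filter_upwards [hvL.coeFn_toLp] with x hx; rw [hx])
    simp only [mem_ofPred_eq, h3] at h2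
    simp only [sub_mul]
    rwa [integral_sub (hwint n v hvm hv1) (hwint k v hvm hv1)]
  have hd := (hw n).sub (hw k)
  set d := hd.1.mk _ with hdd
  have hdm : Measurable d := hd.1.stronglyMeasurable_mk.measurable
  have hde : (w n - w k) =ᵐ[μ] d := hd.1.ae_eq_mk
  set s : α → ℝ := fun x => if 0 ≤ d x then 1 else -1 with hs
  have hsm : Measurable s := Measurable.ite (measurableSet_le measurable_const hdm)
    measurable_const measurable_const
  have hs1 : ∀ x, |s x| ≤ 1 := fun x => by by_cases h : 0 ≤ d x <;> simp [hs, h]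
  have k1 := key s hsm hs1
  have k2 := key 0 measurable_const (by simp)
  have hi : ∀ s : α → ℝ, Measurable s → (∀ x, |s x| ≤ 1) →
      Integrable (fun x => (w n x - w k x) * (E.indicator s x + Eᶜ.indicator (p.1 : α → ℝ) x))
        μ := fun s hs hs1 => by
    refine hd.mul_bdd (c := 1) ((hs.indicator hE).add (hpm.indicator hE.compl)).aestronglyMeasurable
      ?_
    filter_upwards [p.2] with x hx
    by_cases hxE : x ∈ E
    · simpa [hxE] using hs1 x
    · simpa [hxE] using hx
  have h4 : ∫ x in E, |w n x - w k x| ∂μ ≤ ε / 2 := by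
    rw [← integral_indicator hE]
    have : ∫ x, E.indicator (fun x => |w n x - w k x|) x ∂μ =
        ∫ x, ((w n x - w k x) * (E.indicator s x + Eᶜ.indicator (p.1 : α → ℝ) x) -
          (w n x - w k x) * (E.indicator 0 x + Eᶜ.indicator (p.1 : α → ℝ) x)) ∂μ := by
      refine integral_congr_ae ?_
      filter_upwards [hde] with x hx
      by_cases hxE : x ∈ E
      · simp only [Pi.sub_apply] at hx
        simp only [hxE, indicator_of_mem, mem_compl_iff, not_true_eq_false,
          not_false_eq_true, indicator_of_notMem, add_zero, Pi.zero_apply, mul_zero, sub_zero, hx,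
          hs]
        by_cases h : 0 ≤ d x
        · simp [h, abs_of_nonneg h]
        · simp [h, abs_of_neg (not_le.1 h)]
      · simp [hxE]
    rw [this, integral_sub (hi s hsm hs1) (hi 0 measurable_const (by simp))]
    linarith [(abs_le.1 k1).2, (abs_le.1 k2).1]
  calc ∫ x in E, |w n x| ∂μ ≤ ∫ x in E, (|w n x - w k x| + |w k x|) ∂μ := by
        refine integral_mono (hw n).abs.integrableOn
          (hd.abs.integrableOn.add (hw k).abs.integrableOn) fun x => ?_
        have := abs_add_le (w n x - w k x) (w k x)
        simpa using this
    _ ≤ ε := by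
        have hdE : IntegrableOn (fun x => |w n x - w k x|) E μ := hd.abs.integrableOn
        rw [integral_add hdE (hw k).abs.integrableOn]
        linarith

/-- The pairing of a weakly convergent sequence in `L¹` with a bounded sequence converging almost
everywhere passes to the limit. -/
theorem tendsto_integral_mul_of_weak_of_ae {w : ℕ → α → ℝ} {w₀ : α → ℝ}
    (hw : ∀ n, Integrable (w n) μ)
    (hlim : ∀ g : α → ℝ, Measurable g → (∃ C : ℝ, ∀ x, |g x| ≤ C) →
      Tendsto (fun n => ∫ x, w n x * g x ∂μ) atTop (𝓝 (∫ x, w₀ x * g x ∂μ)))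
    {B : ℝ} (hB : ∀ᶠ n in atTop, ∫ x, |w n x| ∂μ ≤ B)
    {g : ℕ → α → ℝ} {g₀ : α → ℝ} {M : ℝ} (hg : ∀ n, AEStronglyMeasurable (g n) μ)
    (hgM : ∀ n, ∀ᵐ x ∂μ, |g n x| ≤ M)
    (hgg : ∀ᵐ x ∂μ, Tendsto (fun n => g n x) atTop (𝓝 (g₀ x))) :
    Tendsto (fun n => ∫ x, w n x * g n x ∂μ) atTop (𝓝 (∫ x, w₀ x * g₀ x ∂μ)) := by
  have hM : ∀ᵐ x ∂μ, ∀ n, |g n x| ≤ M := ae_all_iff.2 hgM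
  have hM₀ : ∀ᵐ x ∂μ, |g₀ x| ≤ M := by
    filter_upwards [hM, hgg] with x h1 h2
    exact le_of_tendsto h2.abs (Eventually.of_forall h1)
  have hg₀ : AEStronglyMeasurable g₀ μ := aestronglyMeasurable_of_tendsto_ae _ hg hgg
  have hMnn : 0 ≤ |M| := abs_nonneg M
  -- a bounded measurable representative of the limit
  obtain ⟨G, hGm, hGb, hGe⟩ : ∃ G : α → ℝ, Measurable G ∧ (∃ C : ℝ, ∀ x, |G x| ≤ C) ∧
      g₀ =ᵐ[μ] G := by
    have hm := hg₀.stronglyMeasurable_mk.measurable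
    refine ⟨fun x => max (-|M|) (min |M| (hg₀.mk g₀ x)), by fun_prop, ⟨|M|, fun x => ?_⟩, ?_⟩
    · rw [abs_le]
      exact ⟨le_max_left _ _, max_le (by linarith) (min_le_left _ _)⟩
    · filter_upwards [hM₀, hg₀.ae_eq_mk] with x hx hx'
      rw [← hx']
      have hx := hx.trans (le_abs_self M)
      rw [abs_le] at hx
      rw [min_eq_right hx.2, max_eq_right hx.1]
  have hfint : ∀ n, Integrable (fun x => w n x * g n x) μ := fun n =>
    (hw n).mul_bdd (hg n) (by simpa using hgM n)
  have hfint' : ∀ n, Integrable (fun x => w n x * g₀ x) μ := fun n =>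
    (hw n).mul_bdd hg₀ (by simpa using hM₀)
  have h1 : Tendsto (fun n => ∫ x, w n x * g₀ x ∂μ) atTop (𝓝 (∫ x, w₀ x * g₀ x ∂μ)) := by
    have := hlim G hGm hGb
    have e : ∀ v : α → ℝ, ∫ x, v x * G x ∂μ = ∫ x, v x * g₀ x ∂μ := fun v =>
      integral_congr_ae (by filter_upwards [hGe] with x hx; rw [hx])
    simpa only [e] using this
  suffices h2 : Tendsto (fun n => ∫ x, w n x * (g n x - g₀ x) ∂μ) atTop (𝓝 0) by
    have h3 := h2.add h1
    rw [zero_add] at h3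
    refine h3.congr fun n => ?_
    simp only [mul_sub]
    rw [integral_sub (hfint n) (hfint' n)]
    ring
  rw [Metric.tendsto_nhds]
  intro ε hε
  set η := ε / (2 * (|B| + 1)) with hη
  have hη0 : 0 < η := by positivity
  obtain ⟨δ, hδ, k, hk⟩ := exists_forall_setIntegral_abs_le_of_weak hw hlim
    (ε := ε / (4 * (2 * |M| + 1))) (by positivity)
  have hmeas := tendstoInMeasure_of_tendsto_ae hg hgg
  rw [tendstoInMeasure_iff_dist] at hmeas
  have hsmall := hmeas η hη0
  have hsmall' : ∀ᶠ n in atTop, μ {x | η ≤ dist (g n x) (g₀ x)} < ENNReal.ofReal δ :=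
    hsmall.eventually (gt_mem_nhds (by simpa using hδ))
  filter_upwards [hsmall', eventually_ge_atTop k, hB] with n hn hnk hBn
  set E := toMeasurable μ {x | η ≤ dist (g n x) (g₀ x)} with hE
  have hEm : MeasurableSet E := measurableSet_toMeasurable _ _
  have hEδ : μ.real E < δ := by
    rw [Measure.real, measure_toMeasurable]
    exact (ENNReal.toReal_lt_toReal (measure_ne_top _ _) (by simp)).2 hn |>.trans_le
      (by rw [ENNReal.toReal_ofReal hδ.le])
  have hEi := hk n hnk E hEm hEδ
  rw [dist_zero_right]
  have hbd : ‖∫ x, w n x * (g n x - g₀ x) ∂μ‖ ≤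
      ∫ x, (η * |w n x| + 2 * |M| * E.indicator (fun x => |w n x|) x) ∂μ := by
    refine norm_integral_le_of_norm_le (((hw n).abs.const_mul _).add
      (((hw n).abs.indicator hEm).const_mul _)) ?_
    filter_upwards [hM, hM₀] with x hx hx₀
    rw [Real.norm_eq_abs, abs_mul]
    by_cases hxE : x ∈ E
    · have : |g n x - g₀ x| ≤ 2 * |M| := by
        calc |g n x - g₀ x| ≤ |g n x| + |g₀ x| := abs_sub _ _
          _ ≤ 2 * |M| := by linarith [hx n, le_abs_self M]
      rw [indicator_of_mem hxE]
      nlinarith [mul_le_mul_of_nonneg_left this (abs_nonneg (w n x)),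
        mul_nonneg hη0.le (abs_nonneg (w n x))]
    · have : |g n x - g₀ x| ≤ η := by
        by_contra! hc
        exact hxE (subset_toMeasurable _ _ (by simpa [Real.dist_eq] using hc.le))
      rw [indicator_of_notMem hxE]
      nlinarith [mul_le_mul_of_nonneg_left this (abs_nonneg (w n x))]
  refine hbd.trans_lt ?_
  rw [integral_add ((hw n).abs.const_mul _) (((hw n).abs.indicator hEm).const_mul _),
    integral_const_mul, integral_const_mul, integral_indicator hEm]
  have a1 : η * ∫ x, |w n x| ∂μ ≤ ε / 2 * (|B| / (|B| + 1)) := by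
    calc η * ∫ x, |w n x| ∂μ ≤ η * |B| := by gcongr; exact hBn.trans (le_abs_self B)
      _ = ε / 2 * (|B| / (|B| + 1)) := by rw [hη]; field_simp
  have a2 : |B| / (|B| + 1) ≤ 1 := by
    rw [div_le_one (by positivity)]; linarith
  have a3 : 2 * |M| * ∫ x in E, |w n x| ∂μ ≤ ε / 4 * (2 * |M| / (2 * |M| + 1)) := by
    calc 2 * |M| * ∫ x in E, |w n x| ∂μ ≤ 2 * |M| * (ε / (4 * (2 * |M| + 1))) := by gcongr
      _ = ε / 4 * (2 * |M| / (2 * |M| + 1)) := by field_simp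
  have a4 : 2 * |M| / (2 * |M| + 1) ≤ 1 := by
    rw [div_le_one (by positivity)]; linarith
  nlinarith

end WeakConvergence

/-- A sequence converging weakly in `L¹` of a bounded set is eventually bounded in `L¹`. -/
theorem exists_eventually_integral_abs_le_of_weak {N : ℕ} [NeZero N] {Ω : Set (Euc N)}
    (hΩm : MeasurableSet Ω) (hΩb : Bornology.IsBounded Ω) {w : ℕ → Euc N → ℝ} {w₀ : Euc N → ℝ}
    (hw : ∀ n, IntegrableOn (w n) Ω) (hlim : WeakL1ConvOn Ω w w₀) :
    ∃ B, ∀ᶠ n in atTop, ∫ x in Ω, |w n x| ≤ B := by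
  have : IsFiniteMeasure (volume.restrict Ω) :=
    isFiniteMeasure_restrict.2 hΩb.measure_lt_top.ne
  obtain ⟨δ, hδ, k, hk⟩ := exists_forall_setIntegral_abs_le_of_weak hw hlim one_pos
  obtain ⟨r, hr, hrδ⟩ : ∃ r > 0, ∀ x : Euc N, (volume : Measure (Euc N)).real (Metric.ball x r) < δ := by
    have h0 : Tendsto (fun r : ℝ => r ^ N * (volume : Measure (Euc N)).real (Metric.ball 0 1))
        (𝓝[>] 0) (𝓝 0) := by
      have : Continuous (fun r : ℝ => r ^ N * (volume : Measure (Euc N)).real (Metric.ball 0 1)) := by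
        fun_prop
      have h := this.tendsto 0
      rw [zero_pow (NeZero.ne N), zero_mul] at h
      exact h.mono_left nhdsWithin_le_nhds
    obtain ⟨r, h1, h2⟩ := ((h0.eventually (gt_mem_nhds hδ)).and self_mem_nhdsWithin).exists
    refine ⟨r, h2, fun x => ?_⟩
    rw [measureReal_def, Measure.addHaar_ball _ _ (le_of_lt h2), ENNReal.toReal_mul,
      finrank_euclideanSpace_fin, ENNReal.toReal_ofReal (pow_nonneg (le_of_lt h2) _)]
    exact h1
  obtain ⟨t, htf, ht⟩ := Metric.totallyBounded_iff.1
    (hΩb.isCompact_closure.totallyBounded.subset subset_closure) r hr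
  lift t to Finset (Euc N) using htf
  refine ⟨∑ x ∈ t, 1, eventually_atTop.2 ⟨k, fun n hn => ?_⟩⟩
  calc ∫ x in Ω, |w n x| ≤ ∫ x in Ω, ∑ y ∈ t, (Metric.ball y r).indicator (fun x => |w n x|) x := by
        refine integral_mono_of_nonneg (Eventually.of_forall fun x => abs_nonneg _)
          (integrable_finsetSum _ fun y _ => (hw n).abs.indicator measurableSet_ball) ?_
        refine (ae_restrict_iff' hΩm).2 (Eventually.of_forall fun x hx => ?_)
        obtain ⟨y, hy, hxy⟩ := mem_iUnion₂.1 (ht hx)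
        calc |w n x| = (Metric.ball y r).indicator (fun x => |w n x|) x := by
              rw [indicator_of_mem hxy]
          _ ≤ _ := Finset.single_le_sum
              (f := fun y => (Metric.ball y r).indicator (fun x => |w n x|) x)
              (fun z _ => indicator_nonneg (fun _ _ => abs_nonneg _) x) hy
    _ = ∑ y ∈ t, ∫ x in Metric.ball y r, |w n x| ∂(volume.restrict Ω) := by
        rw [integral_finsetSum _ fun y _ => (hw n).abs.indicator measurableSet_ball]
        exact Finset.sum_congr rfl fun y _ => integral_indicator measurableSet_ball
    _ ≤ ∑ x ∈ t, 1 := by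
        refine Finset.sum_le_sum fun y _ => hk n hn _ measurableSet_ball ?_
        refine lt_of_le_of_lt ?_ (hrδ y)
        refine ENNReal.toReal_mono measure_ball_lt_top.ne ?_
        exact Measure.restrict_apply_le _ _

/-! ### The energy functional -/

section EnergyFunctional

variable {N : ℕ}

theorem clmMatrix_apply (T : Euc N →L[ℝ] Euc N) (i j : Fin N) :
    clmMatrix T i j = T (EuclideanSpace.single j 1) i := by
  simp [clmMatrix, LinearMap.toMatrix_apply]

theorem trace_eq_sum_clmMatrix (T : Euc N →L[ℝ] Euc N) :
    LinearMap.trace ℝ (Euc N) T.toLinearMap = ∑ i, clmMatrix T i i := by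
  rw [LinearMap.trace_eq_matrix_trace ℝ (EuclideanSpace.basisFun (Fin N) ℝ).toBasis]
  rfl

theorem det_clmMatrix (T : Euc N →L[ℝ] Euc N) : (clmMatrix T).det = T.det :=
  LinearMap.det_toMatrix _ _

theorem DxMatrix_apply {η : Euc N × Euc N → Euc N} (hη : ContDiff ℝ (⊤ : ℕ∞) η) (x ξ : Euc N)
    (i j : Fin N) :
    DxMatrix η x ξ i j = fderiv ℝ η (x, ξ) (EuclideanSpace.single j 1, 0) i := by
  have h1 : HasFDerivAt η (fderiv ℝ η (x, ξ)) (x, ξ) :=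
    (hη.differentiable (by simp) _).hasFDerivAt
  have h2 := HasFDerivAt.comp (g := η) x h1 (hasFDerivAt_prodMk_left (𝕜 := ℝ) x ξ)
  rw [DxMatrix, clmMatrix_apply]
  have h3 := h2.fderiv
  simp only [Function.comp_def] at h3
  rw [h3]
  simp

theorem divXi_eq_sum {η : Euc N × Euc N → Euc N} (hη : ContDiff ℝ (⊤ : ℕ∞) η) (x ξ : Euc N) :
    divXi η x ξ = ∑ i, fderiv ℝ η (x, ξ) (0, EuclideanSpace.single i 1) i := by
  have h1 : HasFDerivAt η (fderiv ℝ η (x, ξ)) (x, ξ) :=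
    (hη.differentiable (by simp) _).hasFDerivAt
  have h2 := HasFDerivAt.comp (g := η) ξ h1 (hasFDerivAt_prodMk_right (𝕜 := ℝ) x ξ)
  rw [divXi, trace_eq_sum_clmMatrix]
  have h3 := h2.fderiv
  simp only [Function.comp_def] at h3
  rw [h3]
  simp [clmMatrix_apply]

theorem continuous_fderiv_apply_coord {η : Euc N × Euc N → Euc N} (hη : ContDiff ℝ (⊤ : ℕ∞) η)
    (v : Euc N × Euc N) (i : Fin N) : Continuous fun p => fderiv ℝ η p v i := by
  have h1 : Continuous (fderiv ℝ η) := hη.continuous_fderiv (by simp)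
  have h2 : Continuous fun p => fderiv ℝ η p v := h1.clm_apply continuous_const
  exact (EuclideanSpace.proj (𝕜 := ℝ) i).continuous.comp h2

theorem exists_bound_fderiv_apply_coord {η : Euc N × Euc N → Euc N}
    (hη : ContDiff ℝ (⊤ : ℕ∞) η) (hc : HasCompactSupport η) (v : Euc N × Euc N) (i : Fin N) :
    ∃ M, ∀ p, |fderiv ℝ η p v i| ≤ M := by
  have h1 : HasCompactSupport fun p => fderiv ℝ η p v i :=
    (hc.fderiv (𝕜 := ℝ)).comp_left (g := fun T : Euc N × Euc N →L[ℝ] Euc N => T v i) (by simp)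
  obtain ⟨M, hM⟩ := h1.exists_bound_of_continuous (continuous_fderiv_apply_coord hη v i)
  exact ⟨M, by simpa using hM⟩

/-- The surface functional with general coefficients in place of the cofactor matrix and of the
determinant. -/
def energyFunctional (Ω : Set (Euc N)) (u : Euc N → Euc N)
    (c : Euc N → Matrix (Fin N) (Fin N) ℝ) (θ : Euc N → ℝ) (η : Euc N × Euc N → Euc N) : ℝ :=
  ∫ x in Ω, (frobInner (c x) (DxMatrix η x (u x)) + divXi η x (u x) * θ x)

variable {Ω : Set (Euc N)} {u : Euc N → Euc N} {c : Euc N → Matrix (Fin N) (Fin N) ℝ}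
  {θ : Euc N → ℝ} {η : Euc N × Euc N → Euc N}

theorem integrableOn_mul_fderiv_apply_coord (hη : ContDiff ℝ (⊤ : ℕ∞) η)
    (hcη : HasCompactSupport η) (hu : AEMeasurable u (volume.restrict Ω))
    {w : Euc N → ℝ} (hw : IntegrableOn w Ω) (v : Euc N × Euc N) (i : Fin N) :
    IntegrableOn (fun x => w x * fderiv ℝ η (x, u x) v i) Ω := by
  obtain ⟨M, hM⟩ := exists_bound_fderiv_apply_coord hη hcη v i
  refine Integrable.mul_bdd (c := M) hw ?_ (Eventually.of_forall fun x => by simpa using hM _)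
  exact ((continuous_fderiv_apply_coord hη v i).measurable.comp_aemeasurable
    (aemeasurable_id.prodMk hu)).aestronglyMeasurable

theorem integrableOn_frobInner (hη : ContDiff ℝ (⊤ : ℕ∞) η)
    (hcη : HasCompactSupport η) (hu : AEMeasurable u (volume.restrict Ω))
    (hc : ∀ i j, IntegrableOn (fun x => c x i j) Ω) :
    IntegrableOn (fun x => frobInner (c x) (DxMatrix η x (u x))) Ω := by
  simp only [frobInner, DxMatrix_apply hη]
  exact integrable_finsetSum _ fun i _ => integrable_finsetSum _ fun j _ =>
    integrableOn_mul_fderiv_apply_coord hη hcη hu (hc i j) _ _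

theorem integrableOn_divXi_mul (hη : ContDiff ℝ (⊤ : ℕ∞) η)
    (hcη : HasCompactSupport η) (hu : AEMeasurable u (volume.restrict Ω))
    (hθ : IntegrableOn θ Ω) :
    IntegrableOn (fun x => divXi η x (u x) * θ x) Ω := by
  simp only [divXi_eq_sum hη, Finset.sum_mul]
  refine integrable_finsetSum _ fun i _ => ?_
  simp only [mul_comm _ (θ _)]
  exact integrableOn_mul_fderiv_apply_coord hη hcη hu hθ _ _

theorem energyFunctional_eq_sum (hη : ContDiff ℝ (⊤ : ℕ∞) η)
    (hcη : HasCompactSupport η) (hu : AEMeasurable u (volume.restrict Ω))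
    (hc : ∀ i j, IntegrableOn (fun x => c x i j) Ω) (hθ : IntegrableOn θ Ω) :
    energyFunctional Ω u c θ η =
      (∑ i, ∑ j, ∫ x in Ω, c x i j * fderiv ℝ η (x, u x) (EuclideanSpace.single j 1, 0) i) +
      ∑ i, ∫ x in Ω, θ x * fderiv ℝ η (x, u x) (0, EuclideanSpace.single i 1) i := by
  rw [energyFunctional, integral_add (integrableOn_frobInner hη hcη hu hc)
    (integrableOn_divXi_mul hη hcη hu hθ)]
  congr 1
  · simp only [frobInner, DxMatrix_apply hη]
    rw [integral_finsetSum _ fun i _ => integrable_finsetSum _ fun j _ =>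
      integrableOn_mul_fderiv_apply_coord hη hcη hu (hc i j) _ _]
    exact Finset.sum_congr rfl fun i _ => integral_finsetSum _ fun j _ =>
      integrableOn_mul_fderiv_apply_coord hη hcη hu (hc i j) _ _
  · simp only [divXi_eq_sum hη, mul_comm _ (θ _), Finset.mul_sum]
    exact integral_finsetSum _ fun i _ => integrableOn_mul_fderiv_apply_coord hη hcη hu hθ _ _

theorem energyFunctional_const_smul (hη : ContDiff ℝ (⊤ : ℕ∞) η) (a : ℝ) :
    energyFunctional Ω u c θ (a • η) = a * energyFunctional Ω u c θ η := by
  have hη' : ContDiff ℝ (⊤ : ℕ∞) (a • η) := contDiff_const.smul hη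
  have hf : ∀ p, fderiv ℝ (a • η) p = a • fderiv ℝ η p := fun p =>
    fderiv_const_smul (hη.differentiable (by simp) p) a
  rw [energyFunctional, energyFunctional, ← integral_const_mul]
  congr 1 with x
  simp only [frobInner, DxMatrix_apply hη, DxMatrix_apply hη', divXi_eq_sum hη, divXi_eq_sum hη',
    hf, _root_.smul_apply, PiLp.smul_apply, smul_eq_mul, mul_add, Finset.mul_sum,
    Finset.sum_mul]
  congr 1
  · exact Finset.sum_congr rfl fun i _ => Finset.sum_congr rfl fun j _ => by ring
  · exact Finset.sum_congr rfl fun i _ => by ring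

theorem energyFunctional_sum {ι : Type*} (t : Finset ι) {η : ι → Euc N × Euc N → Euc N}
    (hη : ∀ k ∈ t, ContDiff ℝ (⊤ : ℕ∞) (η k)) (hcη : ∀ k ∈ t, HasCompactSupport (η k))
    (hu : AEMeasurable u (volume.restrict Ω))
    (hc : ∀ i j, IntegrableOn (fun x => c x i j) Ω) (hθ : IntegrableOn θ Ω) :
    energyFunctional Ω u c θ (fun p => ∑ k ∈ t, η k p) = ∑ k ∈ t, energyFunctional Ω u c θ (η k) := by
  have hη' : ContDiff ℝ (⊤ : ℕ∞) (fun p => ∑ k ∈ t, η k p) := ContDiff.sum hη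
  have hf : ∀ p, fderiv ℝ (fun p => ∑ k ∈ t, η k p) p = ∑ k ∈ t, fderiv ℝ (η k) p := fun p =>
    fderiv_fun_sum fun k hk => (hη k hk).differentiable (by simp) p
  simp only [energyFunctional]
  have hi : ∀ k ∈ t, IntegrableOn (fun x => frobInner (c x) (DxMatrix (η k) x (u x)) +
      divXi (η k) x (u x) * θ x) Ω := fun k hk =>
    (integrableOn_frobInner (hη k hk) (hcη k hk) hu hc).add
      (integrableOn_divXi_mul (hη k hk) (hcη k hk) hu hθ)
  rw [← integral_finsetSum _ hi]
  congr 1 with x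
  rw [Finset.sum_add_distrib, ← Finset.sum_mul]
  congr 1
  · rw [Finset.sum_congr rfl fun k hk => by
      simp only [frobInner, DxMatrix_apply (hη k hk)]
      rfl, Finset.sum_comm]
    simp only [frobInner, DxMatrix_apply hη', hf]
    refine Finset.sum_congr rfl fun i _ => ?_
    rw [Finset.sum_comm]
    refine Finset.sum_congr rfl fun j _ => ?_
    rw [← Finset.mul_sum, sum_apply]
    simp
  · rw [Finset.sum_congr rfl fun k hk => divXi_eq_sum (hη k hk) x (u x), divXi_eq_sum hη',
      Finset.sum_comm]
    simp [hf, sum_apply]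

theorem abs_energyFunctional_le {S : ℝ}
    (hS : ∀ η, TestFun Ω η → energyFunctional Ω u c θ η ≤ S) (hη : ContDiff ℝ (⊤ : ℕ∞) η)
    (hcη : HasCompactSupport η) (hsupp : tsupport η ⊆ Ω ×ˢ (Set.univ : Set (Euc N)))
    {M : ℝ} (hM : 0 < M) (hb : ∀ p, ‖η p‖ ≤ M) :
    |energyFunctional Ω u c θ η| ≤ M * S := by
  have key : ∀ a : ℝ, |a| = M⁻¹ → a * energyFunctional Ω u c θ η ≤ S := fun a ha => by
    rw [← energyFunctional_const_smul hη]
    refine hS _ ⟨contDiff_const.smul hη, hcη.smul_left (f := fun _ => a),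
      (tsupport_smul_subset_right (fun _ => a) η).trans hsupp,
      fun p => ?_⟩
    rw [Pi.smul_apply, norm_smul, Real.norm_eq_abs, ha, inv_mul_le_one₀ hM]
    exact hb p
  have h1 := key M⁻¹ (abs_of_pos (inv_pos.2 hM))
  have h2 := key (-M⁻¹) (by rw [abs_neg, abs_of_pos (inv_pos.2 hM)])
  rw [inv_mul_le_iff₀ hM] at h1
  rw [neg_mul, ← mul_neg, inv_mul_le_iff₀ hM] at h2
  exact abs_le.2 ⟨by linarith, h1⟩

theorem tendsto_energyFunctional [IsFiniteMeasure (volume.restrict Ω)]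
    (hη : ContDiff ℝ (⊤ : ℕ∞) η) (hcη : HasCompactSupport η)
    {us : ℕ → Euc N → Euc N} {cs : ℕ → Euc N → Matrix (Fin N) (Fin N) ℝ} {θs : ℕ → Euc N → ℝ}
    (hus : ∀ n, AEMeasurable (us n) (volume.restrict Ω))
    (hcs : ∀ n i j, IntegrableOn (fun x => cs n x i j) Ω) (hθs : ∀ n, IntegrableOn (θs n) Ω)
    (hu : AEMeasurable u (volume.restrict Ω))
    (hc : ∀ i j, IntegrableOn (fun x => c x i j) Ω) (hθ : IntegrableOn θ Ω)
    {B : ℝ} (hcB : ∀ i j, ∀ᶠ n in atTop, ∫ x in Ω, |cs n x i j| ≤ B)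
    (hθB : ∀ᶠ n in atTop, ∫ x in Ω, |θs n x| ≤ B)
    (hcw : ∀ i j, WeakL1ConvOn Ω (fun n x => cs n x i j) (fun x => c x i j))
    (hθw : WeakL1ConvOn Ω θs θ)
    (huu : ∀ᵐ x ∂(volume.restrict Ω), Tendsto (fun n => us n x) atTop (𝓝 (u x))) :
    Tendsto (fun n => energyFunctional Ω (us n) (cs n) (θs n) η) atTop
      (𝓝 (energyFunctional Ω u c θ η)) := by
  have key : ∀ {w : ℕ → Euc N → ℝ} {w₀ : Euc N → ℝ}, (∀ n, IntegrableOn (w n) Ω) →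
      WeakL1ConvOn Ω w w₀ → (∀ᶠ n in atTop, ∫ x in Ω, |w n x| ≤ B) → ∀ v i,
      Tendsto (fun n => ∫ x in Ω, w n x * fderiv ℝ η (x, us n x) v i) atTop
        (𝓝 (∫ x in Ω, w₀ x * fderiv ℝ η (x, u x) v i)) := by
    intro w w₀ hw hww hB v i
    obtain ⟨M, hM⟩ := exists_bound_fderiv_apply_coord hη hcη v i
    have hcont := continuous_fderiv_apply_coord hη v i
    refine tendsto_integral_mul_of_weak_of_ae (M := M) hw hww hB (fun n => ?_)
      (fun n => Eventually.of_forall fun x => hM _) ?_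
    · exact (hcont.measurable.comp_aemeasurable
        (aemeasurable_id.prodMk (hus n))).aestronglyMeasurable
    · filter_upwards [huu] with x hx
      exact (hcont.tendsto (x, u x)).comp (tendsto_const_nhds.prodMk_nhds hx)
  rw [energyFunctional_eq_sum hη hcη hu hc hθ]
  simp only [fun n => energyFunctional_eq_sum hη hcη (hus n) (hcs n) (hθs n)]
  refine Tendsto.add ?_ ?_
  · exact tendsto_finsetSum _ fun i _ => tendsto_finsetSum _ fun j _ =>
      key (fun n => hcs n i j) (hcw i j) (hcB i j) _ _
  · exact tendsto_finsetSum _ fun i _ => key hθs hθw hθB _ _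

end EnergyFunctional

theorem ApproxDiffTriple.aemeasurable {N : ℕ} {A D : Set (Euc N)} {u : Euc N → Euc N}
    {f : Euc N → Euc N →L[ℝ] Euc N} (h : ApproxDiffTriple A D u f) :
    AEMeasurable u (volume.restrict A) := by
  obtain ⟨hD, hDA, h0, hd⟩ := h
  have h1 : ContinuousOn u D := fun x hx => (hd x hx).continuousWithinAt
  have h2 : volume.restrict A = volume.restrict D :=
    Measure.restrict_congr_set (ae_eq_set.2 ⟨h0, by rw [sdiff_eq_empty.2 hDA, measure_empty]⟩)
  rw [h2]
  exact h1.aemeasurable hD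

theorem ApproxDiffTriple.ae_mem {N : ℕ} {A D : Set (Euc N)} {u : Euc N → Euc N}
    {f : Euc N → Euc N →L[ℝ] Euc N} (h : ApproxDiffTriple A D u f) (hA : MeasurableSet A) :
    ∀ᵐ x ∂volume.restrict A, x ∈ D := by
  rw [ae_restrict_iff' hA, ae_iff]
  refine measure_mono_null (fun x hx => ?_) h.2.2.1
  simpa using hx

/-! ### Test functions in product form -/

section ProductTestFunction

variable {N : ℕ} {a : Euc N → ℝ} {T : Euc N → Euc N}

theorem contDiff_smul_prod (ha : ContDiff ℝ (⊤ : ℕ∞) a) (hT : ContDiff ℝ (⊤ : ℕ∞) T) :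
    ContDiff ℝ (⊤ : ℕ∞) (fun p : Euc N × Euc N => a p.1 • T p.2) :=
  (ha.comp contDiff_fst).smul (hT.comp contDiff_snd)

theorem tsupport_smul_prod_subset (a : Euc N → ℝ) (T : Euc N → Euc N) :
    tsupport (fun p : Euc N × Euc N => a p.1 • T p.2) ⊆ tsupport a ×ˢ tsupport T := by
  refine closure_minimal (fun p hp => ?_) ((isClosed_tsupport _).prod (isClosed_tsupport _))
  rw [Function.mem_support, smul_ne_zero_iff] at hp
  exact ⟨subset_tsupport _ hp.1, subset_tsupport _ hp.2⟩

theorem hasCompactSupport_smul_prod (ha : HasCompactSupport a) (hT : HasCompactSupport T) :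
    HasCompactSupport (fun p : Euc N × Euc N => a p.1 • T p.2) :=
  (ha.isCompact.prod hT.isCompact).of_isClosed_subset (isClosed_tsupport _)
    (tsupport_smul_prod_subset a T)

theorem fderiv_smul_prod_apply (ha : ContDiff ℝ (⊤ : ℕ∞) a) (hT : ContDiff ℝ (⊤ : ℕ∞) T)
    (x ξ v w : Euc N) :
    fderiv ℝ (fun p : Euc N × Euc N => a p.1 • T p.2) (x, ξ) (v, w) =
      fderiv ℝ a x v • T ξ + a x • fderiv ℝ T ξ w := by
  have h1 : HasFDerivAt (fun p : Euc N × Euc N => a p.1)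
      ((fderiv ℝ a x).comp (ContinuousLinearMap.fst ℝ _ _)) (x, ξ) :=
    HasFDerivAt.comp (g := a) (f := Prod.fst) (x, ξ)
      (ha.differentiable (by simp) x).hasFDerivAt hasFDerivAt_fst
  have h2 : HasFDerivAt (fun p : Euc N × Euc N => T p.2)
      ((fderiv ℝ T ξ).comp (ContinuousLinearMap.snd ℝ _ _)) (x, ξ) :=
    HasFDerivAt.comp (g := T) (f := Prod.snd) (x, ξ)
      (hT.differentiable (by simp) ξ).hasFDerivAt hasFDerivAt_snd
  have h3 : HasFDerivAt (fun p : Euc N × Euc N => a p.1 • T p.2) _ (x, ξ) := h1.smul h2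
  rw [h3.fderiv]
  simp [add_comm]

theorem frobInner_DxMatrix_smul_prod (ha : ContDiff ℝ (⊤ : ℕ∞) a) (hT : ContDiff ℝ (⊤ : ℕ∞) T)
    (A : Matrix (Fin N) (Fin N) ℝ) (x ξ : Euc N) :
    frobInner A (DxMatrix (fun p : Euc N × Euc N => a p.1 • T p.2) x ξ) =
      ∑ i, ∑ j, A i j * (fderiv ℝ a x (EuclideanSpace.single j 1) * T ξ i) := by
  simp [frobInner, DxMatrix_apply (contDiff_smul_prod ha hT), fderiv_smul_prod_apply ha hT]

theorem divXi_smul_prod (ha : ContDiff ℝ (⊤ : ℕ∞) a) (hT : ContDiff ℝ (⊤ : ℕ∞) T) (x ξ : Euc N) :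
    divXi (fun p : Euc N × Euc N => a p.1 • T p.2) x ξ =
      a x * LinearMap.trace ℝ (Euc N) (fderiv ℝ T ξ).toLinearMap := by
  simp [divXi_eq_sum (contDiff_smul_prod ha hT), fderiv_smul_prod_apply ha hT,
    trace_eq_sum_clmMatrix, clmMatrix_apply, Finset.mul_sum]

end ProductTestFunction

/-! ### Blow-up at Lebesgue points -/

section BlowUp

variable {N : ℕ} {Ω : Set (Euc N)}

theorem ae_tendsto_integral_closedBall_abs_sub (hΩ : IsOpen Ω) {w : Euc N → ℝ}
    (hw : IntegrableOn w Ω) :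
    ∀ᵐ x ∂volume.restrict Ω,
      Tendsto (fun r : ℝ => (r ^ N)⁻¹ * ∫ y in Metric.closedBall x r, |w y - w x|)
        (𝓝[>] 0) (𝓝 0) := by
  have h1 : LocallyIntegrable (Ω.indicator w) volume :=
    (hw.integrable_indicator hΩ.measurableSet).locallyIntegrable
  have h2 := (Besicovitch.vitaliFamily (volume : Measure (Euc N))).ae_tendsto_average_norm_sub h1
  rw [ae_restrict_iff' hΩ.measurableSet]
  filter_upwards [h2] with x hx hxΩ
  have h3 := hx.comp (Besicovitch.tendsto_filterAt volume x)
  have h4 := h3.const_mul ((volume : Measure (Euc N)).real (Metric.closedBall 0 1))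
  rw [mul_zero] at h4
  refine h4.congr' ?_
  obtain ⟨ρ, hρ, hball⟩ := Metric.isOpen_iff.1 hΩ x hxΩ
  filter_upwards [Ioo_mem_nhdsGT hρ] with r hr
  have h5 : (volume : Measure (Euc N)).real (Metric.closedBall x r) =
      r ^ N * (volume : Measure (Euc N)).real (Metric.closedBall 0 1) := by
    rw [measureReal_def, Measure.addHaar_closedBall' _ _ hr.1.le, ENNReal.toReal_mul,
      finrank_euclideanSpace_fin, ENNReal.toReal_ofReal (pow_nonneg hr.1.le _), measureReal_def]
  have h6 : 0 < (volume : Measure (Euc N)).real (Metric.closedBall 0 1) :=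
    ENNReal.toReal_pos (Metric.measure_closedBall_pos _ _ one_pos).ne' measure_closedBall_lt_top.ne
  simp only [Function.comp_apply]
  rw [setAverage_eq, h5, smul_eq_mul, mul_inv]
  have h7 : ∫ y in Metric.closedBall x r, ‖Ω.indicator w y - Ω.indicator w x‖ =
      ∫ y in Metric.closedBall x r, |w y - w x| := by
    refine setIntegral_congr_fun Metric.isClosed_closedBall.measurableSet fun y hy => ?_
    have hy' : y ∈ Ω := hball (Metric.closedBall_subset_ball hr.2 hy)
    simp [hy', hxΩ]
  rw [h7]
  field_simp

theorem clm_apply_eq_sum (L : Euc N →L[ℝ] ℝ) (z : Euc N) :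
    L z = ∑ i, z i * L (EuclideanSpace.single i 1) := by
  conv_lhs => rw [← (EuclideanSpace.basisFun (Fin N) ℝ).sum_repr z]
  simp [map_sum]

/-- Integration by parts against the position field. -/
theorem integral_fderiv_apply_self {φ : Euc N → ℝ} (hφ : ContDiff ℝ (⊤ : ℕ∞) φ)
    (hc : HasCompactSupport φ) : ∫ z, fderiv ℝ φ z z = -(N * ∫ z, φ z) := by
  have h0 : ∀ z : Euc N, fderiv ℝ φ z z = ∑ i, z i * fderiv ℝ φ z (EuclideanSpace.single i 1) :=
    fun z => clm_apply_eq_sum _ z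
  have hcf : Continuous (fderiv ℝ φ) := hφ.continuous_fderiv (by simp)
  have hpr : ∀ i, Continuous fun z : Euc N => z i := fun i =>
    (EuclideanSpace.proj (𝕜 := ℝ) i).continuous
  have hd : ∀ i (z : Euc N), HasFDerivAt (fun z : Euc N => z i)
      (EuclideanSpace.proj (𝕜 := ℝ) i) z := fun i z => (EuclideanSpace.proj (𝕜 := ℝ) i).hasFDerivAt
  have hc1 : ∀ v : Euc N, HasCompactSupport fun z => fderiv ℝ φ z v := fun v =>
    hc.fderiv_apply (𝕜 := ℝ) v
  have hfint : ∀ i, Integrable fun z : Euc N => z i * fderiv ℝ φ z (EuclideanSpace.single i 1) :=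
    fun i => ((hpr i).mul (hcf.clm_apply continuous_const)).integrable_of_hasCompactSupport
      (hc1 _).mul_left
  have hdv : ∀ i (z : Euc N), fderiv ℝ (fun z : Euc N => z i) z (EuclideanSpace.single i 1) = 1 :=
    fun i z => by rw [(hd i z).fderiv]; simp
  simp only [h0]
  rw [integral_finsetSum _ fun i _ => hfint i]
  have h1 : ∀ i : Fin N, ∫ z : Euc N, z i * fderiv ℝ φ z (EuclideanSpace.single i 1) = -∫ z, φ z := by
    intro i
    rw [integral_mul_fderiv_eq_neg_fderiv_mul_of_integrable]
    · simp [hdv]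
    · simp only [hdv, one_mul]
      exact hφ.continuous.integrable_of_hasCompactSupport hc
    · exact hfint i
    · exact ((hpr i).mul hφ.continuous).integrable_of_hasCompactSupport hc.mul_left
    · exact fun z _ => (hd i z).differentiableAt
    · exact fun z _ => hφ.differentiable (by simp) z
  simp [h1]

/-- The cofactor matrix contracted with `∇φ(z) ⊗ F z`. -/
theorem sum_cofCLM_mul (F : Euc N →L[ℝ] Euc N) (L : Euc N →L[ℝ] ℝ) (z : Euc N) :
    ∑ i, ∑ j, cofCLM F i j * (L (EuclideanSpace.single j 1) * F z i) = F.det * L z := by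
  have hz : z = ∑ k, z k • EuclideanSpace.single k (1 : ℝ) := by
    conv_lhs => rw [← (EuclideanSpace.basisFun (Fin N) ℝ).sum_repr z]
    simp
  have h1 : ∀ i, F z i = ∑ k, clmMatrix F i k * z k := fun i => by
    conv_lhs => rw [hz]
    simp [map_sum, clmMatrix_apply, mul_comm]
  have h2 : ∀ j k, ∑ i, cofCLM F i j * clmMatrix F i k = if j = k then F.det else 0 := by
    intro j k
    have := congrFun (congrFun (Matrix.adjugate_mul (clmMatrix F)) j) k
    rw [Matrix.mul_apply, det_clmMatrix] at this
    simp only [cofCLM, Matrix.transpose_apply, this]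
    simp [Matrix.one_apply]
  rw [Finset.sum_comm, clm_apply_eq_sum L, Finset.mul_sum]
  refine Finset.sum_congr rfl fun j _ => ?_
  calc ∑ i, cofCLM F i j * (L (EuclideanSpace.single j 1) * F z i)
      = ∑ k, (∑ i, cofCLM F i j * clmMatrix F i k) * (L (EuclideanSpace.single j 1) * z k) := by
        simp only [h1, Finset.mul_sum, Finset.sum_mul]
        rw [Finset.sum_comm]
        exact Finset.sum_congr rfl fun k _ => Finset.sum_congr rfl fun i _ => by ring
    _ = _ := by
        simp only [h2, ite_mul, zero_mul, Finset.sum_ite_eq, Finset.mem_univ, if_true]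
        ring

end BlowUp

section BlowUpTestFunction

variable {N : ℕ} {Ω : Set (Euc N)}

theorem fderiv_comp_inv_smul_sub {F : Type*} [NormedAddCommGroup F] [NormedSpace ℝ F]
    {ψ : Euc N → F} (hψ : Differentiable ℝ ψ) (r : ℝ) (x₀ x v : Euc N) :
    fderiv ℝ (fun x => ψ (r⁻¹ • (x - x₀))) x v = r⁻¹ • fderiv ℝ ψ (r⁻¹ • (x - x₀)) v := by
  have h1 : HasFDerivAt (fun x : Euc N => r⁻¹ • (x - x₀)) (r⁻¹ • ContinuousLinearMap.id ℝ (Euc N)) x :=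
    ((hasFDerivAt_id x).sub_const x₀).const_smul r⁻¹
  have h2 : HasFDerivAt (fun x => ψ (r⁻¹ • (x - x₀))) _ x :=
    HasFDerivAt.comp (g := ψ) x (hψ _).hasFDerivAt h1
  rw [h2.fderiv]
  simp

theorem contDiff_comp_inv_smul_sub {F : Type*} [NormedAddCommGroup F] [NormedSpace ℝ F]
    {ψ : Euc N → F} (hψ : ContDiff ℝ (⊤ : ℕ∞) ψ) (r : ℝ) (x₀ : Euc N) :
    ContDiff ℝ (⊤ : ℕ∞) (fun x => ψ (r⁻¹ • (x - x₀))) :=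
  hψ.comp ((contDiff_id.sub contDiff_const).const_smul r⁻¹)

theorem support_comp_inv_smul_sub_subset {F : Type*} [NormedAddCommGroup F] [NormedSpace ℝ F]
    {ψ : Euc N → F} {R r : ℝ} (hψ : Function.support ψ ⊆ Metric.closedBall 0 R) (hr : 0 < r)
    (x₀ : Euc N) :
    Function.support (fun x => ψ (r⁻¹ • (x - x₀))) ⊆ Metric.closedBall x₀ (r * R) := by
  intro x hx
  have h1 := hψ (Function.mem_support.2 hx)
  rw [mem_closedBall_zero_iff, norm_smul, norm_inv, Real.norm_of_nonneg hr.le,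
    inv_mul_le_iff₀ hr] at h1
  rwa [mem_closedBall_iff_norm]

/-- The energy density of a rescaled product test function. -/
theorem energyDensity_rescaled {φ : Euc N → ℝ} {g : Euc N → Euc N}
    (hφ : ContDiff ℝ (⊤ : ℕ∞) φ) (hg : ContDiff ℝ (⊤ : ℕ∞) g) {r : ℝ} (hr : r ≠ 0)
    (x₀ ξ₀ x ξ : Euc N) (A : Matrix (Fin N) (Fin N) ℝ) (t : ℝ) :
    r * (frobInner A (DxMatrix (fun p : Euc N × Euc N =>
        φ (r⁻¹ • (p.1 - x₀)) • g (r⁻¹ • (p.2 - ξ₀))) x ξ) +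
      divXi (fun p : Euc N × Euc N => φ (r⁻¹ • (p.1 - x₀)) • g (r⁻¹ • (p.2 - ξ₀))) x ξ * t) =
    (∑ i, ∑ j, A i j * (fderiv ℝ φ (r⁻¹ • (x - x₀)) (EuclideanSpace.single j 1) *
        g (r⁻¹ • (ξ - ξ₀)) i)) +
      φ (r⁻¹ • (x - x₀)) *
        (∑ i, fderiv ℝ g (r⁻¹ • (ξ - ξ₀)) (EuclideanSpace.single i 1) i) * t := by
  rw [frobInner_DxMatrix_smul_prod (contDiff_comp_inv_smul_sub hφ r x₀)
    (contDiff_comp_inv_smul_sub hg r ξ₀), divXi_smul_prod (contDiff_comp_inv_smul_sub hφ r x₀)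
    (contDiff_comp_inv_smul_sub hg r ξ₀)]
  simp only [trace_eq_sum_clmMatrix, clmMatrix_apply,
    fderiv_comp_inv_smul_sub (hφ.differentiable (by simp)),
    fderiv_comp_inv_smul_sub (hg.differentiable (by simp)), PiLp.smul_apply, smul_eq_mul]
  have hrr : r * r⁻¹ = 1 := mul_inv_cancel₀ hr
  rw [mul_add, Finset.mul_sum]
  congr 1
  · refine Finset.sum_congr rfl fun i _ => ?_
    rw [Finset.mul_sum]
    refine Finset.sum_congr rfl fun j _ => ?_
    linear_combination (A i j * fderiv ℝ φ (r⁻¹ • (x - x₀)) (EuclideanSpace.single j 1) *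
      g (r⁻¹ • (ξ - ξ₀)) i) * hrr
  · simp only [← Finset.mul_sum]
    linear_combination (φ (r⁻¹ • (x - x₀)) *
      (∑ i, fderiv ℝ g (r⁻¹ • (ξ - ξ₀)) (EuclideanSpace.single i 1) i) * t) * hrr

/-- Pointwise comparison of the rescaled energy density with its blow-up limit. -/
theorem abs_energyDensity_sub_le {A A₀ : Matrix (Fin N) (Fin N) ℝ} {t t₀ p q M C ε : ℝ}
    {L : Euc N →L[ℝ] ℝ} {w w₀ : Euc N} (hp : |p| ≤ 1) (hC : 0 ≤ C) (hL : ‖L‖ ≤ C)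
    (hw : ‖w‖ ≤ M) (hww : ‖w - w₀‖ ≤ ε) (hq : 0 ≤ q) :
    |((∑ i, ∑ j, A i j * (L (EuclideanSpace.single j 1) * w i)) + p * q * t) -
      ((∑ i, ∑ j, A₀ i j * (L (EuclideanSpace.single j 1) * w₀ i)) + p * q * t₀)| ≤
    (∑ i, ∑ j, |A i j - A₀ i j| * (C * M)) + (∑ i, ∑ j, |A₀ i j| * (C * ε)) + q * |t - t₀| := by
  have hLj : ∀ j, |L (EuclideanSpace.single j 1)| ≤ C := fun j => by
    have : |L (EuclideanSpace.single j 1)| ≤ ‖L‖ := by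
      simpa using L.le_opNorm (EuclideanSpace.single j 1)
    exact this.trans hL
  have hco : ∀ (v : Euc N) i, |v i| ≤ ‖v‖ := fun v i => by
    simpa using PiLp.norm_apply_le v i
  have h1 : ((∑ i, ∑ j, A i j * (L (EuclideanSpace.single j 1) * w i)) + p * q * t) -
      ((∑ i, ∑ j, A₀ i j * (L (EuclideanSpace.single j 1) * w₀ i)) + p * q * t₀) =
      (∑ i, ∑ j, (A i j - A₀ i j) * (L (EuclideanSpace.single j 1) * w i)) +
      (∑ i, ∑ j, A₀ i j * (L (EuclideanSpace.single j 1) * (w - w₀) i)) + p * q * (t - t₀) := by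
    have : ∀ i, (w - w₀) i = w i - w₀ i := fun i => rfl
    simp only [this, sub_mul, mul_sub, Finset.sum_sub_distrib]
    ring
  rw [h1]
  refine (abs_add_le _ _).trans (add_le_add ((abs_add_le _ _).trans (add_le_add ?_ ?_)) ?_)
  · refine (Finset.abs_sum_le_sum_abs _ _).trans (Finset.sum_le_sum fun i _ =>
      (Finset.abs_sum_le_sum_abs _ _).trans (Finset.sum_le_sum fun j _ => ?_))
    rw [abs_mul, abs_mul]
    gcongr
    · exact hLj j
    · exact (hco w i).trans hw
  · refine (Finset.abs_sum_le_sum_abs _ _).trans (Finset.sum_le_sum fun i _ =>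
      (Finset.abs_sum_le_sum_abs _ _).trans (Finset.sum_le_sum fun j _ => ?_))
    rw [abs_mul, abs_mul]
    gcongr
    · exact hLj j
    · exact (hco _ i).trans hww
  · rw [abs_mul, abs_mul, abs_of_nonneg hq]
    have := mul_le_mul_of_nonneg_right hp (mul_nonneg hq (abs_nonneg (t - t₀)))
    linarith

end BlowUpTestFunction

section BlowUpLimit

variable {N : ℕ} {Ω D : Set (Euc N)} {u : Euc N → Euc N} {f : Euc N → Euc N →L[ℝ] Euc N}

/-- The rescaled energies of a product test function converge at a Lebesgue point. -/
theorem tendsto_energyFunctional_rescaled (hΩ : IsOpen Ω) (htri : ApproxDiffTriple Ω D u f)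
    {θ : Euc N → ℝ} (hcint : ∀ i j, IntegrableOn (fun x => cofCLM (f x) i j) Ω)
    (hθint : IntegrableOn θ Ω) {x₀ : Euc N} (hx₀ : x₀ ∈ D)
    (hcL : ∀ i j, Tendsto (fun r : ℝ => (r ^ N)⁻¹ *
      ∫ y in Metric.closedBall x₀ r, |cofCLM (f y) i j - cofCLM (f x₀) i j|) (𝓝[>] 0) (𝓝 0))
    (hθL : Tendsto (fun r : ℝ => (r ^ N)⁻¹ *
      ∫ y in Metric.closedBall x₀ r, |θ y - θ x₀|) (𝓝[>] 0) (𝓝 0))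
    {φ : Euc N → ℝ} {g : Euc N → Euc N} (hφ : ContDiff ℝ (⊤ : ℕ∞) φ)
    (hφs : Function.support φ ⊆ Metric.closedBall 0 1) (hφ1 : ∀ z, |φ z| ≤ 1)
    (hg : ContDiff ℝ (⊤ : ℕ∞) g) (hgc : HasCompactSupport g)
    (hgid : ∀ w ∈ Metric.ball (0 : Euc N) (‖f x₀‖ + 1), g w = w) :
    Tendsto (fun r : ℝ => (r ^ N)⁻¹ * (r * energyFunctional Ω u (fun x => cofCLM (f x)) θ
      (fun p => φ (r⁻¹ • (p.1 - x₀)) • g (r⁻¹ • (p.2 - u x₀))))) (𝓝[>] 0)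
      (𝓝 (N * (θ x₀ - (f x₀).det) * ∫ z, φ z)) := by
  have hφc : HasCompactSupport φ :=
    HasCompactSupport.intro (isCompact_closedBall (0 : Euc N) 1) fun z hz => by
      by_contra h
      exact hz (hφs h)
  have hcφ' : Continuous (fderiv ℝ φ) := hφ.continuous_fderiv (by simp)
  obtain ⟨C, hC⟩ := hcφ'.bounded_above_of_compact_support (hφc.fderiv (𝕜 := ℝ))
  have hC0 : 0 ≤ C := (norm_nonneg _).trans (hC 0)
  have hu := htri.aemeasurable
  set F := f x₀ with hF
  set P : Euc N → ℝ := fun z => (∑ i, ∑ j, cofCLM F i j *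
    (fderiv ℝ φ z (EuclideanSpace.single j 1) * F z i)) + φ z * N * θ x₀ with hP
  have hP' : ∀ z, P z = F.det * fderiv ℝ φ z z + (N * θ x₀) * φ z := fun z => by
    simp only [hP, sum_cofCLM_mul]; ring
  have hi1 : Integrable fun z => fderiv ℝ φ z z :=
    (hcφ'.clm_apply continuous_id).integrable_of_hasCompactSupport
      ((hφc.fderiv (𝕜 := ℝ)).mono fun z hz => by
        contrapose! hz
        rw [Function.notMem_support] at hz ⊢
        rw [hz, _root_.zero_apply])
  have hi2 : Integrable φ := hφ.continuous.integrable_of_hasCompactSupport hφc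
  have hPint : Integrable P := by
    simp only [funext hP']
    exact (hi1.const_mul _).add (hi2.const_mul _)
  have hPI : ∫ z, P z = N * (θ x₀ - F.det) * ∫ z, φ z := by
    simp only [hP']
    rw [integral_add (hi1.const_mul _) (hi2.const_mul _), integral_const_mul, integral_const_mul,
      integral_fderiv_apply_self hφ hφc]
    ring
  have hPs : ∀ z, z ∉ Metric.closedBall (0 : Euc N) 1 → φ z = 0 ∧ fderiv ℝ φ z = 0 := fun z hz => by
    refine ⟨by_contra fun h => hz (hφs h), image_eq_zero_of_notMem_tsupport fun h => hz ?_⟩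
    exact closure_minimal hφs Metric.isClosed_closedBall (tsupport_fderiv_subset ℝ h)
  set V : ℝ := (volume : Measure (Euc N)).real (Metric.closedBall 0 1) with hV
  set E : ℝ → ℝ := fun r => (r ^ N)⁻¹ * (r * energyFunctional Ω u (fun x => cofCLM (f x)) θ
      (fun p => φ (r⁻¹ • (p.1 - x₀)) • g (r⁻¹ • (p.2 - u x₀)))) with hE
  set W : ℝ → ℝ := fun r => (∑ i, ∑ j, ((r ^ N)⁻¹ *
      ∫ y in Metric.closedBall x₀ r, |cofCLM (f y) i j - cofCLM F i j|) * (C * (‖F‖ + 1))) +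
    N * ((r ^ N)⁻¹ * ∫ y in Metric.closedBall x₀ r, |θ y - θ x₀|) with hW
  have hW0 : Tendsto W (𝓝[>] 0) (𝓝 0) := by
    have h1 := (tendsto_finsetSum Finset.univ fun i _ => tendsto_finsetSum Finset.univ fun j _ =>
      (hcL i j).mul_const (C * (‖F‖ + 1))).add (hθL.const_mul (N : ℝ))
    simpa [hW] using h1
  have key : ∀ ε : ℝ, 0 < ε → ε < 1 → ∀ᶠ r in 𝓝[>] (0 : ℝ),
      |E r - ∫ z, P z| ≤ W r + (∑ i, ∑ j, |cofCLM F i j| * (C * ε)) * V := by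
    intro ε hε hε1
    have hfd := (htri.2.2.2 x₀ hx₀).isLittleO.def hε
    obtain ⟨ρ₁, hρ₁, hd⟩ := Metric.mem_nhdsWithin_iff.1 hfd
    obtain ⟨ρ₂, hρ₂, hball⟩ := Metric.isOpen_iff.1 hΩ x₀ (htri.2.1 hx₀)
    filter_upwards [Ioo_mem_nhdsGT (lt_min hρ₁ hρ₂)] with r hr
    have hr0 : 0 < r := hr.1
    have hrN : 0 < r ^ N := pow_pos hr0 N
    set B := Metric.closedBall x₀ r with hB
    have hBm : MeasurableSet B := Metric.isClosed_closedBall.measurableSet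
    have hBΩ : B ⊆ Ω :=
      (Metric.closedBall_subset_ball (hr.2.trans_le (min_le_right _ _))).trans hball
    set η : Euc N × Euc N → Euc N :=
      fun p => φ (r⁻¹ • (p.1 - x₀)) • g (r⁻¹ • (p.2 - u x₀)) with hη
    set dens : Euc N → ℝ := fun x =>
      frobInner (cofCLM (f x)) (DxMatrix η x (u x)) + divXi η x (u x) * θ x with hdens
    have hrd : ∀ x, r * dens x = _ := fun x =>
      energyDensity_rescaled hφ hg hr0.ne' x₀ (u x₀) x (u x) (cofCLM (f x)) (θ x)
    have hzB : ∀ x, x ∉ B → r⁻¹ • (x - x₀) ∉ Metric.closedBall (0 : Euc N) 1 := fun x hx h => by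
      rw [mem_closedBall_zero_iff, norm_smul, norm_inv, Real.norm_of_nonneg hr0.le,
        inv_mul_le_iff₀ hr0, mul_one] at h
      exact hx (mem_closedBall_iff_norm.2 h)
    have hηsm : ContDiff ℝ (⊤ : ℕ∞) η :=
      contDiff_smul_prod (contDiff_comp_inv_smul_sub hφ r x₀) (contDiff_comp_inv_smul_sub hg r (u x₀))
    have hcs : ∀ {F' : Type} [NormedAddCommGroup F'] [NormedSpace ℝ F'] {ψ : Euc N → F'}
        (v : Euc N), HasCompactSupport ψ → HasCompactSupport fun x => ψ (r⁻¹ • (x - v)) :=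
      fun {F'} _ _ {ψ} v hψ => hψ.comp_homeomorph
        ((Homeomorph.subRight v).trans (Homeomorph.smulOfNeZero r⁻¹ (inv_ne_zero hr0.ne')))
    have hηc : HasCompactSupport η := hasCompactSupport_smul_prod
      (a := fun x => φ (r⁻¹ • (x - x₀))) (T := fun x => g (r⁻¹ • (x - u x₀)))
      (hcs x₀ hφc) (hcs (u x₀) hgc)
    have hdi : IntegrableOn dens Ω :=
      (integrableOn_frobInner hηsm hηc hu hcint).add (integrableOn_divXi_mul hηsm hηc hu hθint)
    have hen : r * energyFunctional Ω u (fun x => cofCLM (f x)) θ η = ∫ x in B, r * dens x := by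
      rw [integral_const_mul]
      congr 1
      refine setIntegral_eq_of_subset_of_forall_sdiff_eq_zero hΩ.measurableSet hBΩ fun x hx => ?_
      have h1 := hPs _ (hzB x hx.2)
      have h2 := hrd x
      simp only [h1.1, h1.2, zero_mul, mul_zero, _root_.zero_apply,
        Finset.sum_const_zero, add_zero] at h2
      exact (mul_eq_zero.1 h2).resolve_left hr0.ne'
    have hPr : ∫ z, P z = (r ^ N)⁻¹ * ∫ x in B, P (r⁻¹ • (x - x₀)) := by
      have h1 : ∫ x in B, P (r⁻¹ • (x - x₀)) = ∫ x, P (r⁻¹ • (x - x₀)) := by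
        refine setIntegral_eq_integral_of_forall_compl_eq_zero fun x hx => ?_
        have h1 := hPs _ (hzB x hx)
        simp [hP', h1.1, h1.2]
      rw [h1, integral_sub_right_eq_self (fun x => P (r⁻¹ • x)) x₀,
        Measure.integral_comp_inv_smul_of_nonneg _ _ hr0.le, finrank_euclideanSpace_fin,
        smul_eq_mul, inv_mul_cancel_left₀ hrN.ne']
    have hPBi : IntegrableOn (fun x => P (r⁻¹ • (x - x₀))) B :=
      ((hPint.comp_smul (inv_ne_zero hr0.ne')).comp_sub_right x₀).integrableOn
    have hfB : volume B ≠ ⊤ := measure_closedBall_lt_top.ne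
    have hVB : (volume : Measure (Euc N)).real B = r ^ N * V := by
      rw [measureReal_def, Measure.addHaar_closedBall' _ _ hr0.le, ENNReal.toReal_mul,
        finrank_euclideanSpace_fin, ENNReal.toReal_ofReal (pow_nonneg hr0.le _), hV,
        measureReal_def]
    set bd : Euc N → ℝ := fun x =>
      (∑ i, ∑ j, |cofCLM (f x) i j - cofCLM F i j| * (C * (‖F‖ + 1))) +
      (∑ i, ∑ j, |cofCLM F i j| * (C * ε)) + N * |θ x - θ x₀| with hbd
    have hbc : ∀ i j, IntegrableOn (fun x => |cofCLM (f x) i j - cofCLM F i j|) B := fun i j =>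
      (((hcint i j).mono_set hBΩ).sub (integrableOn_const hfB)).abs
    have hbθ : IntegrableOn (fun x => |θ x - θ x₀|) B :=
      ((hθint.mono_set hBΩ).sub (integrableOn_const hfB)).abs
    have hbs : IntegrableOn
        (fun x => ∑ i, ∑ j, |cofCLM (f x) i j - cofCLM F i j| * (C * (‖F‖ + 1))) B :=
      integrable_finsetSum _ fun i _ => integrable_finsetSum _ fun j _ => (hbc i j).mul_const _
    have hbk : IntegrableOn (fun _ => ∑ i, ∑ j, |cofCLM F i j| * (C * ε)) B :=
      integrableOn_const hfB
    have hbi : IntegrableOn bd B := (hbs.add hbk).add (hbθ.const_mul _)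
    have hbI : (r ^ N)⁻¹ * ∫ x in B, bd x =
        W r + (∑ i, ∑ j, |cofCLM F i j| * (C * ε)) * V := by
      have h1 : ∫ x in B, bd x = (∑ i, ∑ j, (∫ x in B, |cofCLM (f x) i j - cofCLM F i j|) *
          (C * (‖F‖ + 1))) + r ^ N * V * (∑ i, ∑ j, |cofCLM F i j| * (C * ε)) +
          N * ∫ x in B, |θ x - θ x₀| := by
        refine ((integral_add (hbs.add hbk) (hbθ.const_mul _)).trans
          (congrArg (· + _) (integral_add hbs hbk))).trans ?_
        rw [integral_const_mul, setIntegral_const, hVB, smul_eq_mul]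
        have h2 : ∫ x in B, (∑ i, ∑ j, |cofCLM (f x) i j - cofCLM F i j| * (C * (‖F‖ + 1))) =
            ∑ i, ∑ j, (∫ x in B, |cofCLM (f x) i j - cofCLM F i j|) * (C * (‖F‖ + 1)) := by
          rw [integral_finsetSum _ fun i _ =>
            integrable_finsetSum _ fun j _ => (hbc i j).mul_const _]
          refine Finset.sum_congr rfl fun i _ => ?_
          rw [integral_finsetSum _ fun j _ => (hbc i j).mul_const _]
          exact Finset.sum_congr rfl fun j _ => integral_mul_const _ _
        rw [h2]
      have h2 : (r ^ N)⁻¹ * (∑ i, ∑ j, (∫ x in B, |cofCLM (f x) i j - cofCLM F i j|) *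
          (C * (‖F‖ + 1))) = ∑ i, ∑ j, ((r ^ N)⁻¹ *
            ∫ x in B, |cofCLM (f x) i j - cofCLM F i j|) * (C * (‖F‖ + 1)) := by
        simp only [Finset.mul_sum, mul_assoc]
      have h3 := inv_mul_cancel₀ hrN.ne'
      rw [h1, hW, mul_add, mul_add, h2]
      linear_combination (V * ∑ i, ∑ j, |cofCLM F i j| * (C * ε)) * h3
    have hpt : ∀ᵐ x ∂volume.restrict B, |r * dens x - P (r⁻¹ • (x - x₀))| ≤ bd x := by
      have hDm := ae_mono (Measure.restrict_mono hBΩ le_rfl) (htri.ae_mem hΩ.measurableSet)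
      filter_upwards [hDm, ae_restrict_mem hBm] with x hxD hxB
      have hxr : ‖x - x₀‖ ≤ r := mem_closedBall_iff_norm.1 hxB
      have h1 : ‖u x - u x₀ - F (x - x₀)‖ ≤ ε * ‖x - x₀‖ :=
        hd ⟨Metric.mem_ball.2 ((Metric.mem_closedBall.1 hxB).trans_lt
          (hr.2.trans_le (min_le_left _ _))), hxD⟩
      have hww : ‖r⁻¹ • (u x - u x₀) - F (r⁻¹ • (x - x₀))‖ ≤ ε := by
        rw [map_smul, ← smul_sub, norm_smul, norm_inv, Real.norm_of_nonneg hr0.le,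
          inv_mul_le_iff₀ hr0, mul_comm]
        exact h1.trans (mul_le_mul_of_nonneg_left hxr hε.le)
      have hz1 : ‖r⁻¹ • (x - x₀)‖ ≤ 1 := by
        rw [norm_smul, norm_inv, Real.norm_of_nonneg hr0.le, inv_mul_le_iff₀ hr0, mul_one]
        exact hxr
      have hFz : ‖F (r⁻¹ • (x - x₀))‖ ≤ ‖F‖ :=
        (F.le_opNorm _).trans (mul_le_of_le_one_right (norm_nonneg _) hz1)
      have hw : ‖r⁻¹ • (u x - u x₀)‖ < ‖F‖ + 1 := by
        have := norm_add_le (r⁻¹ • (u x - u x₀) - F (r⁻¹ • (x - x₀))) (F (r⁻¹ • (x - x₀)))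
        rw [sub_add_cancel] at this
        linarith
      have hwb : r⁻¹ • (u x - u x₀) ∈ Metric.ball (0 : Euc N) (‖F‖ + 1) :=
        mem_ball_zero_iff.2 hw
      have hgd : fderiv ℝ g (r⁻¹ • (u x - u x₀)) = ContinuousLinearMap.id ℝ (Euc N) := by
        have : g =ᶠ[𝓝 (r⁻¹ • (u x - u x₀))] id := by
          filter_upwards [Metric.isOpen_ball.mem_nhds hwb] with w hw using hgid w hw
        rw [this.fderiv_eq, fderiv_id]
      rw [hrd x, hgid _ hwb, hgd]
      have h2 : (∑ i : Fin N, (ContinuousLinearMap.id ℝ (Euc N)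
          (EuclideanSpace.single i (1 : ℝ))) i) = N := by simp
      rw [h2]
      exact abs_energyDensity_sub_le (hφ1 _) hC0 (hC _) hw.le hww N.cast_nonneg
    have hEP : E r - ∫ z, P z =
        (r ^ N)⁻¹ * ∫ x in B, (r * dens x - P (r⁻¹ • (x - x₀))) := by
      rw [integral_sub ((hdi.mono_set hBΩ).const_mul r) hPBi, mul_sub, ← hPr, ← hen]
    rw [hEP, ← hbI, abs_mul, abs_of_pos (inv_pos.2 hrN)]
    refine mul_le_mul_of_nonneg_left ?_ (inv_pos.2 hrN).le
    exact norm_integral_le_of_norm_le (f := fun x => r * dens x - P (r⁻¹ • (x - x₀))) hbi hpt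
  rw [← hPI]
  rw [Metric.tendsto_nhds]
  intro δ hδ
  set K := ∑ i, ∑ j, |cofCLM F i j| * C with hK
  have hK0 : 0 ≤ K := Finset.sum_nonneg fun i _ => Finset.sum_nonneg fun j _ => by positivity
  have hV0 : 0 ≤ V := measureReal_nonneg
  obtain ⟨ε, hε0, hε1, hε2⟩ : ∃ ε : ℝ, 0 < ε ∧ ε < 1 ∧ K * V * ε < δ / 2 := by
    refine ⟨min (1 / 2) (δ / (2 * (K * V + 1))), by positivity, by
      refine (min_le_left _ _).trans_lt (by norm_num), ?_⟩
    have hKV : 0 ≤ K * V := by positivity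
    have h1 : min (1 / 2) (δ / (2 * (K * V + 1))) ≤ δ / (2 * (K * V + 1)) := min_le_right _ _
    have h2 : K * V * (δ / (2 * (K * V + 1))) < δ / 2 := by
      rw [← mul_div_assoc, div_lt_div_iff₀ (by positivity) two_pos]
      nlinarith
    exact (mul_le_mul_of_nonneg_left h1 hKV).trans_lt h2
  filter_upwards [key ε hε0 hε1, hW0.eventually_lt_const (half_pos hδ)] with r h1 h2
  rw [Real.dist_eq]
  have h3 : (∑ i, ∑ j, |cofCLM F i j| * (C * ε)) * V = K * V * ε := by
    simp only [hK, ← mul_assoc, ← Finset.sum_mul]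
    ring
  change |E r - _| < δ
  linarith

end BlowUpLimit

section DeterminantIdentification

variable {N : ℕ} {Ω D : Set (Euc N)} {u : Euc N → Euc N} {f : Euc N → Euc N →L[ℝ] Euc N}

theorem eventually_exists_large_energyFunctional (hΩ : IsOpen Ω) (hN : 0 < N)
    (htri : ApproxDiffTriple Ω D u f)
    {θ : Euc N → ℝ} (hcint : ∀ i j, IntegrableOn (fun x => cofCLM (f x) i j) Ω)
    (hθint : IntegrableOn θ Ω) {x₀ : Euc N} (hx₀ : x₀ ∈ D)
    (hcL : ∀ i j, Tendsto (fun r : ℝ => (r ^ N)⁻¹ *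
      ∫ y in Metric.closedBall x₀ r, |cofCLM (f y) i j - cofCLM (f x₀) i j|) (𝓝[>] 0) (𝓝 0))
    (hθL : Tendsto (fun r : ℝ => (r ^ N)⁻¹ *
      ∫ y in Metric.closedBall x₀ r, |θ y - θ x₀|) (𝓝[>] 0) (𝓝 0))
    (hne : θ x₀ ≠ (f x₀).det) {K : ℝ} (hK : 0 < K) :
    ∀ᶠ r in 𝓝[>] (0 : ℝ), ∃ η : Euc N × Euc N → Euc N, ContDiff ℝ (⊤ : ℕ∞) η ∧
      HasCompactSupport η ∧ (∀ p : Euc N × Euc N, p.1 ∉ Metric.closedBall x₀ r → η p = 0) ∧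
      (∀ p, ‖η p‖ ≤ 1) ∧ K * r ^ N ≤ energyFunctional Ω u (fun x => cofCLM (f x)) θ η := by
  let φ : ContDiffBump (0 : Euc N) := ⟨1 / 2, 1, by norm_num, by norm_num⟩
  let χ : ContDiffBump (0 : Euc N) :=
    ⟨‖f x₀‖ + 1, ‖f x₀‖ + 2, by positivity, by linarith⟩
  set G : ℝ := ‖f x₀‖ + 2 with hG
  have hG0 : 0 < G := by positivity
  set g : Euc N → Euc N := fun w => χ w • w with hg
  have hgs : ContDiff ℝ (⊤ : ℕ∞) g := χ.contDiff.smul contDiff_id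
  have hgc : HasCompactSupport g := χ.hasCompactSupport.smul_right
  have hgid : ∀ w ∈ Metric.ball (0 : Euc N) (‖f x₀‖ + 1), g w = w := fun w hw => by
    simp [hg, χ.one_of_mem_closedBall (Metric.ball_subset_closedBall hw)]
  have hgG : ∀ w, ‖g w‖ ≤ G := fun w => by
    by_cases hw : w ∈ Function.support χ
    · rw [χ.support_eq, mem_ball_zero_iff] at hw
      rw [hg, norm_smul, Real.norm_of_nonneg χ.nonneg]
      exact (mul_le_of_le_one_left (norm_nonneg _) χ.le_one).trans hw.le
    · rw [Function.notMem_support] at hw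
      simp [hg, hw, hG0.le]
  have hφs : Function.support φ ⊆ Metric.closedBall 0 1 := by
    rw [φ.support_eq]
    exact Metric.ball_subset_closedBall
  have hφ1 : ∀ z, |φ z| ≤ 1 := fun z => by
    rw [abs_of_nonneg φ.nonneg]
    exact φ.le_one
  have hlim := tendsto_energyFunctional_rescaled hΩ htri hcint hθint hx₀ hcL hθL φ.contDiff hφs hφ1
    hgs hgc hgid
  set l : ℝ := N * (θ x₀ - (f x₀).det) * ∫ z, φ z with hl
  have hl0 : l ≠ 0 := mul_ne_zero (mul_ne_zero (by exact_mod_cast hN.ne') (sub_ne_zero.2 hne))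
    φ.integral_pos.ne'
  have hl1 : |l| / 2 < |l| := half_lt_self (abs_pos.2 hl0)
  have hsm : 0 < |l| / (2 * G * K) := div_pos (abs_pos.2 hl0) (by positivity)
  filter_upwards [hlim.abs.eventually_const_lt hl1, Ioo_mem_nhdsGT hsm] with r h1 hr
  have hr0 : 0 < r := hr.1
  have hrN : 0 < r ^ N := pow_pos hr0 N
  set η : Euc N × Euc N → Euc N :=
    fun p => φ (r⁻¹ • (p.1 - x₀)) • g (r⁻¹ • (p.2 - u x₀)) with hη
  set Λ := energyFunctional Ω u (fun x => cofCLM (f x)) θ η with hΛ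
  have hηsm : ContDiff ℝ (⊤ : ℕ∞) η :=
    contDiff_smul_prod (contDiff_comp_inv_smul_sub φ.contDiff r x₀)
      (contDiff_comp_inv_smul_sub hgs r (u x₀))
  have hηc : HasCompactSupport η := by
    refine hasCompactSupport_smul_prod (a := fun x => φ (r⁻¹ • (x - x₀)))
      (T := fun x => g (r⁻¹ • (x - u x₀))) ?_ ?_
    · exact φ.hasCompactSupport.comp_homeomorph ((Homeomorph.subRight x₀).trans
        (Homeomorph.smulOfNeZero r⁻¹ (inv_ne_zero hr0.ne')))
    · exact hgc.comp_homeomorph ((Homeomorph.subRight (u x₀)).trans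
        (Homeomorph.smulOfNeZero r⁻¹ (inv_ne_zero hr0.ne')))
  have hη0 : ∀ p : Euc N × Euc N, p.1 ∉ Metric.closedBall x₀ r → η p = 0 := fun p hp => by
    have h2 := support_comp_inv_smul_sub_subset hφs hr0 x₀
    rw [mul_one] at h2
    have h3 : φ (r⁻¹ • (p.1 - x₀)) = 0 := by_contra fun h => hp (h2 h)
    simp only [hη, h3, zero_smul]
  have hηG : ∀ p, ‖η p‖ ≤ G := fun p => by
    rw [hη, norm_smul]
    exact (mul_le_of_le_one_left (norm_nonneg _) (hφ1 _)).trans (hgG _)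
  have hbig : K * r ^ N ≤ G⁻¹ * |Λ| := by
    rw [abs_mul (r ^ N)⁻¹, abs_mul r, abs_of_pos hr0, abs_of_pos (inv_pos.2 hrN), lt_inv_mul_iff₀ hrN] at h1
    rw [le_inv_mul_iff₀ hG0]
    have h2 : r * (2 * G * K) < |l| := by
      have := hr.2
      rwa [lt_div_iff₀ (by positivity)] at this
    have h3 : r ^ N * (r * (2 * G * K) / 2) ≤ r ^ N * (|l| / 2) := by gcongr
    refine le_of_mul_le_mul_left ?_ hr0
    linarith
  obtain ⟨s, hs1, hs2⟩ : ∃ s : ℝ, |s| = 1 ∧ s * Λ = |Λ| := by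
    rcases le_total 0 Λ with h | h
    · exact ⟨1, by simp, by rw [one_mul, abs_of_nonneg h]⟩
    · exact ⟨-1, by simp, by rw [abs_of_nonpos h]; ring⟩
  refine ⟨(G⁻¹ * s) • η, show ContDiff ℝ _ fun p => (G⁻¹ * s) • η p from hηsm.const_smul _, hηc.smul_left (f := fun _ => G⁻¹ * s),
    fun p hp => by simp [hη0 p hp], fun p => ?_, ?_⟩
  · rw [Pi.smul_apply, norm_smul, norm_mul, Real.norm_eq_abs s, hs1, mul_one, norm_inv,
      Real.norm_of_nonneg hG0.le, inv_mul_le_iff₀ hG0, mul_one]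
    exact hηG p
  · rw [energyFunctional_const_smul hηsm, mul_assoc, hs2]
    exact hbig

/-- Bounded surface energy forces the density of the `ξ`-divergence to be the Jacobian. -/
theorem ae_eq_det_of_energyFunctional_le (hΩ : IsOpen Ω) (hN : 0 < N)
    (htri : ApproxDiffTriple Ω D u f)
    {θ : Euc N → ℝ} (hcint : ∀ i j, IntegrableOn (fun x => cofCLM (f x) i j) Ω)
    (hθint : IntegrableOn θ Ω) {S : ℝ}
    (hS : ∀ η, TestFun Ω η → energyFunctional Ω u (fun x => cofCLM (f x)) θ η ≤ S) :
    ∀ᵐ x ∂volume.restrict Ω, θ x = (f x).det := by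
  have hcL := fun i j => ae_tendsto_integral_closedBall_abs_sub hΩ (hcint i j)
  have hθL := ae_tendsto_integral_closedBall_abs_sub hΩ hθint
  have hu := htri.aemeasurable
  set V : ℝ := (volume : Measure (Euc N)).real (Metric.closedBall 0 1) with hV
  have hV0 : 0 < V :=
    ENNReal.toReal_pos (Metric.measure_closedBall_pos _ _ one_pos).ne' measure_closedBall_lt_top.ne
  set s : Set (Euc N) := {x | x ∈ D ∧ θ x ≠ (f x).det ∧
    (∀ i j, Tendsto (fun r : ℝ => (r ^ N)⁻¹ *
      ∫ y in Metric.closedBall x r, |cofCLM (f y) i j - cofCLM (f x) i j|) (𝓝[>] 0) (𝓝 0)) ∧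
    Tendsto (fun r : ℝ => (r ^ N)⁻¹ *
      ∫ y in Metric.closedBall x r, |θ y - θ x|) (𝓝[>] 0) (𝓝 0)} with hs
  suffices hs0 : volume s = 0 by
    have h1 : ∀ᵐ x ∂volume.restrict Ω, x ∉ s :=
      ae_restrict_of_ae (measure_eq_zero_iff_ae_notMem.1 hs0)
    filter_upwards [h1, ae_all_iff.2 fun i => ae_all_iff.2 (hcL i), hθL,
      htri.ae_mem hΩ.measurableSet] with x h1 h2 h3 h4
    by_contra h5
    exact h1 ⟨h4, h5, h2, h3⟩
  have key : ∀ K : ℝ, 0 < K → volume s ≤ ENNReal.ofReal (V * (S / K)) := by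
    intro K hK
    set good : Euc N → Set ℝ := fun x => {r | Metric.closedBall x r ⊆ Ω ∧
      ∃ η : Euc N × Euc N → Euc N, ContDiff ℝ (⊤ : ℕ∞) η ∧
      HasCompactSupport η ∧ (∀ p : Euc N × Euc N, p.1 ∉ Metric.closedBall x r → η p = 0) ∧
      (∀ p, ‖η p‖ ≤ 1) ∧ K * r ^ N ≤ energyFunctional Ω u (fun x => cofCLM (f x)) θ η} with hgood
    have hfreq : ∀ x ∈ s, ∀ δ > 0, (good x ∩ Ioo 0 δ).Nonempty := by
      intro x hx δ hδ
      obtain ⟨ρ, hρ, hball⟩ := Metric.isOpen_iff.1 hΩ x (htri.2.1 hx.1)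
      obtain ⟨r, hr1, hr2⟩ := ((eventually_exists_large_energyFunctional hΩ hN htri hcint hθint
        hx.1 hx.2.2.1 hx.2.2.2 hx.2.1 hK).and (Ioo_mem_nhdsGT (lt_min hρ hδ))).exists
      exact ⟨r, ⟨(Metric.closedBall_subset_ball (hr2.2.trans_le (min_le_left _ _))).trans hball,
        hr1⟩, hr2.1, hr2.2.trans_le (min_le_right _ _)⟩
    obtain ⟨t, r, htc, hts, htr, hcov, hdisj⟩ :=
      Besicovitch.exists_disjoint_closedBall_covering_ae volume good s hfreq (fun _ => 1)
        (fun _ _ => one_pos)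
    have hcountable := htc.to_subtype
    choose! η hη1 hη2 hη3 hη4 hη5 using fun x (hx : x ∈ t) => (htr x hx).1.2
    have hfin : ∀ F : Finset t, ∑ x ∈ F, r x ^ N ≤ S / K := by
      intro F
      have h1 : TestFun Ω (fun p => ∑ x ∈ F, η x p) := by
        have hz : ∀ p : Euc N × Euc N, (∀ x ∈ F, p.1 ∉ Metric.closedBall (x : Euc N) (r x)) →
            ∑ x ∈ F, η x p = 0 := fun p hp =>
          Finset.sum_eq_zero fun x hx => hη3 x x.2 p (hp x hx)
        refine ⟨ContDiff.sum fun x _ => hη1 x x.2, ?_, ?_, fun p => ?_⟩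
        · refine HasCompactSupport.of_support_subset_isCompact
            (F.isCompact_biUnion fun x _ => (hη2 x x.2).isCompact) fun p hp => ?_
          obtain ⟨x, hx, hxp⟩ := Finset.exists_ne_zero_of_sum_ne_zero (Function.mem_support.1 hp)
          exact mem_iUnion₂.2 ⟨x, hx, subset_tsupport _ hxp⟩
        · have hcl : IsClosed ((⋃ x ∈ F, Metric.closedBall (x : Euc N) (r x)) ×ˢ
              (univ : Set (Euc N))) :=
            (F.finite_toSet.isClosed_biUnion fun _ _ => Metric.isClosed_closedBall).prod
              isClosed_univ
          refine (closure_minimal (fun p hp => ?_) hcl).trans (prod_mono (iUnion₂_subset fun x _ =>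
            (htr x x.2).1.1) subset_rfl)
          by_contra h
          exact hp (hz p fun x hx hxp => h ⟨mem_iUnion₂.2 ⟨x, hx, hxp⟩, mem_univ _⟩)
        · change ‖∑ x ∈ F, η x p‖ ≤ 1
          by_cases h : ∃ x ∈ F, p.1 ∈ Metric.closedBall (x : Euc N) (r x)
          · obtain ⟨x, hx, hxp⟩ := h
            rw [Finset.sum_eq_single x (fun y _ hyx => hη3 y y.2 p fun hyp =>
              (Set.disjoint_left.1 (hdisj y.2 x.2 (Subtype.coe_injective.ne hyx)) hyp) hxp)
              fun h => (h hx).elim]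
            exact hη4 x x.2 p
          · push Not at h
            rw [hz p h, norm_zero]
            exact zero_le_one
      have h2 := hS _ h1
      rw [energyFunctional_sum F (fun k _ => hη1 k k.2) (fun k _ => hη2 k k.2) hu hcint hθint] at h2
      rw [le_div_iff₀ hK, Finset.sum_mul]
      refine (Finset.sum_le_sum fun x _ => ?_).trans h2
      rw [mul_comm]
      exact hη5 x x.2
    have hball : ∀ x ∈ t, volume (Metric.closedBall x (r x)) = ENNReal.ofReal (V * r x ^ N) := by
      intro x hx
      rw [Measure.addHaar_closedBall' _ _ (htr x hx).2.1.le, finrank_euclideanSpace_fin, mul_comm V,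
        ENNReal.ofReal_mul (pow_nonneg (htr x hx).2.1.le _), hV, measureReal_def,
        ENNReal.ofReal_toReal measure_closedBall_lt_top.ne]
    calc volume s ≤ volume (⋃ x ∈ t, Metric.closedBall x (r x)) := by
          refine (measure_mono_ae ?_)
          rw [ae_le_set]
          exact hcov
      _ ≤ ∑' x : t, volume (Metric.closedBall (x : Euc N) (r x)) := measure_biUnion_le _ htc _
      _ ≤ ENNReal.ofReal (V * (S / K)) := by
          rw [ENNReal.tsum_eq_iSup_sum]
          refine iSup_le fun F => ?_
          rw [Finset.sum_congr rfl fun (x : t) _ => hball x x.2, ← ENNReal.ofReal_sum_of_nonneg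
            fun (x : t) _ => mul_nonneg hV0.le (pow_nonneg (htr x x.2).2.1.le _), ← Finset.mul_sum]
          exact ENNReal.ofReal_le_ofReal (mul_le_mul_of_nonneg_left (hfin F) hV0.le)
  have hlim : Tendsto (fun K : ℝ => ENNReal.ofReal (V * (S / K))) atTop (𝓝 0) := by
    have : Tendsto (fun K : ℝ => V * (S / K)) atTop (𝓝 (V * 0)) :=
      (tendsto_const_nhds.div_atTop tendsto_id).const_mul V
    simpa using ENNReal.tendsto_ofReal this
  exact le_antisymm (ge_of_tendsto hlim ((eventually_gt_atTop 0).mono key)) zero_le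

end DeterminantIdentification

/-! ### A radial mollifier in divergence form -/

section RadialKernel

/-- A smooth function equal to `1` for small `t` and to `t ^ (-N / 2)` for `1 ≤ t`. -/
def radialProfile (N : ℕ) (t : ℝ) : ℝ :=
  (1 - Real.smoothTransition (2 * t - 1)) +
    Real.smoothTransition (2 * t - 1) * t ^ (-(N : ℝ) / 2)

/-- The divergence of `z ↦ radialProfile N (‖z‖ ^ 2) • z` as a function of `‖z‖ ^ 2`. -/
def radialDensity (N : ℕ) (t : ℝ) : ℝ :=
  N * radialProfile N t + 2 * t * deriv (radialProfile N) t

variable (N : ℕ)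

theorem radialProfile_of_le {t : ℝ} (ht : t ≤ 1 / 2) : radialProfile N t = 1 := by
  simp [radialProfile, Real.smoothTransition.zero_of_nonpos (show 2 * t - 1 ≤ 0 by linarith)]

theorem radialProfile_of_one_le {t : ℝ} (ht : 1 ≤ t) :
    radialProfile N t = t ^ (-(N : ℝ) / 2) := by
  simp [radialProfile, Real.smoothTransition.one_of_one_le (show 1 ≤ 2 * t - 1 by linarith)]

theorem radialProfile_nonneg {t : ℝ} (ht : 0 ≤ t) : 0 ≤ radialProfile N t :=
  add_nonneg (sub_nonneg.2 (Real.smoothTransition.le_one _))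
    (mul_nonneg (Real.smoothTransition.nonneg _) (Real.rpow_nonneg ht _))

theorem radialProfile_le {t : ℝ} (ht : 0 < t) : radialProfile N t ≤ t ^ (-(N : ℝ) / 2) := by
  rcases le_total 1 t with h | h
  · exact (radialProfile_of_one_le N h).le
  · have h1 : 1 ≤ t ^ (-(N : ℝ) / 2) :=
      Real.one_le_rpow_of_pos_of_le_one_of_nonpos ht h
        (div_nonpos_of_nonpos_of_nonneg (neg_nonpos.2 N.cast_nonneg) two_pos.le)
    have h2 := Real.smoothTransition.le_one (2 * t - 1)
    simp only [radialProfile]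
    nlinarith

theorem contDiff_radialProfile : ContDiff ℝ (⊤ : ℕ∞) (radialProfile N) := by
  rw [contDiff_iff_contDiffAt]
  intro t
  rcases lt_or_ge t (1 / 2) with h | h
  · refine (contDiffAt_const (c := (1 : ℝ))).congr_of_eventuallyEq ?_
    filter_upwards [Iio_mem_nhds h] with x hx using radialProfile_of_le N (le_of_lt hx)
  · have h1 : ContDiffAt ℝ (⊤ : ℕ∞) (fun t : ℝ => Real.smoothTransition (2 * t - 1)) t :=
      (Real.smoothTransition.contDiff.comp
        ((contDiff_const.mul contDiff_id).sub contDiff_const)).contDiffAt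
    exact (contDiffAt_const.sub h1).add
      (h1.mul (Real.contDiffAt_rpow_const_of_ne (by linarith)))

theorem continuous_radialDensity : Continuous (radialDensity N) := by
  have h := (contDiff_radialProfile N).continuous_deriv (by simp)
  have h2 := (contDiff_radialProfile N).continuous
  unfold radialDensity
  fun_prop

theorem radialDensity_of_lt {t : ℝ} (ht : t < 1 / 2) : radialDensity N t = N := by
  have h1 : radialProfile N =ᶠ[𝓝 t] fun _ => 1 := by
    filter_upwards [Iio_mem_nhds ht] with x hx using radialProfile_of_le N (le_of_lt hx)
  rw [radialDensity, h1.deriv_eq, deriv_const, radialProfile_of_le N ht.le]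
  ring

theorem radialDensity_of_pos {t : ℝ} (ht : 0 < t) :
    ∃ m : ℝ, 0 ≤ m ∧ radialDensity N t =
      N * (1 - Real.smoothTransition (2 * t - 1)) + m * (t ^ (-(N : ℝ) / 2) - 1) := by
  have h0 : HasDerivAt (fun t : ℝ => 2 * t - 1) 2 t := by
    simpa using ((hasDerivAt_id t).const_mul 2).sub_const 1
  have hd : Differentiable ℝ Real.smoothTransition :=
    (Real.smoothTransition.contDiff (n := 1)).differentiable (by simp)
  set d := deriv Real.smoothTransition (2 * t - 1) with hdef
  have hd0 : 0 ≤ d := Real.smoothTransition.monotone.deriv_nonneg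
  have h1 : HasDerivAt (fun t : ℝ => Real.smoothTransition (2 * t - 1)) (d * 2) t :=
    HasDerivAt.comp t (hd _).hasDerivAt h0
  have h2 : HasDerivAt (fun t : ℝ => t ^ (-(N : ℝ) / 2)) _ t :=
    Real.hasDerivAt_rpow_const (Or.inl ht.ne')
  have h3 : HasDerivAt (radialProfile N) _ t := (h1.const_sub 1).add (h1.mul h2)
  refine ⟨4 * t * d, by positivity, ?_⟩
  have h4 : t * t ^ (-(N : ℝ) / 2 - 1) = t ^ (-(N : ℝ) / 2) := by
    rw [Real.rpow_sub_one ht.ne']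
    field_simp
  rw [radialDensity, h3.deriv, radialProfile]
  linear_combination (-(N : ℝ) * Real.smoothTransition (2 * t - 1)) * h4

theorem radialDensity_of_one_le {t : ℝ} (ht : 1 ≤ t) : radialDensity N t = 0 := by
  rcases ht.eq_or_lt with rfl | ht
  · obtain ⟨m, -, h⟩ := radialDensity_of_pos N one_pos
    rw [h, Real.one_rpow, Real.smoothTransition.one_of_one_le (by norm_num)]
    ring
  · have ht0 : 0 < t := one_pos.trans ht
    have h1 : radialProfile N =ᶠ[𝓝 t] fun t => t ^ (-(N : ℝ) / 2) := by
      filter_upwards [Ioi_mem_nhds ht] with x hx using radialProfile_of_one_le N (le_of_lt hx)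
    have h2 : HasDerivAt (fun t : ℝ => t ^ (-(N : ℝ) / 2)) _ t :=
      Real.hasDerivAt_rpow_const (Or.inl ht0.ne')
    rw [radialDensity, h1.deriv_eq, h2.deriv, h1.eq_of_nhds, Real.rpow_sub_one ht0.ne']
    field_simp
    ring

theorem radialDensity_nonneg {t : ℝ} (ht : 0 ≤ t) : 0 ≤ radialDensity N t := by
  rcases ht.eq_or_lt with rfl | ht
  · rw [radialDensity_of_lt N (by norm_num)]
    exact N.cast_nonneg
  obtain ⟨m, hm, h⟩ := radialDensity_of_pos N ht
  rcases le_total 1 t with h1 | h1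
  · exact (radialDensity_of_one_le N h1).ge
  · have h2 : 1 ≤ t ^ (-(N : ℝ) / 2) :=
      Real.one_le_rpow_of_pos_of_le_one_of_nonpos ht h1
        (div_nonpos_of_nonpos_of_nonneg (neg_nonpos.2 N.cast_nonneg) two_pos.le)
    rw [h]
    exact add_nonneg (mul_nonneg N.cast_nonneg (sub_nonneg.2 (Real.smoothTransition.le_one _)))
      (mul_nonneg hm (sub_nonneg.2 h2))

end RadialKernel

section MassKernel

variable {N : ℕ}

/-- A smooth vector field equal to `z / ‖z‖ ^ N` outside the ball of radius `s`. -/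
def radialField (s : ℝ) (z : Euc N) : Euc N :=
  ((s ^ N)⁻¹ * radialProfile N (‖z‖ ^ 2 / s ^ 2)) • z

/-- The divergence of `radialField s`, a mollifier at scale `s`. -/
def massKernel (s : ℝ) (z : Euc N) : ℝ :=
  (s ^ N)⁻¹ * radialDensity N (‖z‖ ^ 2 / s ^ 2)

theorem contDiff_radialField (s : ℝ) : ContDiff ℝ (⊤ : ℕ∞) (radialField s : Euc N → Euc N) :=
  (contDiff_const.mul ((contDiff_radialProfile N).comp
    ((contDiff_norm_sq ℝ).div_const _))).smul contDiff_id

theorem trace_fderiv_radialField (s : ℝ) (z : Euc N) :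
    LinearMap.trace ℝ (Euc N) (fderiv ℝ (radialField s) z).toLinearMap = massKernel s z := by
  have h0 : HasFDerivAt (fun z : Euc N => ‖z‖ ^ 2 / s ^ 2)
      ((s ^ 2)⁻¹ • ((2 : ℝ) • innerSL ℝ z)) z := by
    have := (hasStrictFDerivAt_norm_sq z).hasFDerivAt.const_mul (s ^ 2)⁻¹
    simpa only [div_eq_inv_mul, two_smul] using this
  have h1 : HasDerivAt (radialProfile N) (deriv (radialProfile N) (‖z‖ ^ 2 / s ^ 2))
      (‖z‖ ^ 2 / s ^ 2) :=
    ((contDiff_radialProfile N).differentiable (by simp) _).hasDerivAt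
  have h2 := (h1.comp_hasFDerivAt z h0).const_mul (s ^ N)⁻¹
  have h3 : HasFDerivAt (radialField s) _ z := h2.smul (hasFDerivAt_id z)
  rw [h3.fderiv, trace_eq_sum_clmMatrix]
  have h4 : ∑ i, z i * z i = ‖z‖ ^ 2 := by
    rw [EuclideanSpace.norm_sq_eq]
    exact Finset.sum_congr rfl fun i _ => by rw [Real.norm_eq_abs, sq_abs, sq]
  simp only [clmMatrix_apply]
  have h5 : ∀ i : Fin N, inner ℝ z (EuclideanSpace.single i (1 : ℝ)) = z i := fun i => by
    simp [EuclideanSpace.inner_single_right]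
  have h6 : ∑ i, (s ^ N)⁻¹ * (deriv (radialProfile N) (‖z‖ ^ 2 / s ^ 2) *
      ((s ^ 2)⁻¹ * (2 * z i))) * z i =
      2 * (s ^ N)⁻¹ * deriv (radialProfile N) (‖z‖ ^ 2 / s ^ 2) * (s ^ 2)⁻¹ * ‖z‖ ^ 2 := by
    rw [← h4, Finset.mul_sum]
    exact Finset.sum_congr rfl fun i _ => by ring
  simp only [Function.comp_apply, _root_.add_apply, _root_.smul_apply, PiLp.add_apply,
    PiLp.smul_apply, ContinuousLinearMap.smulRight_apply, ContinuousLinearMap.id_apply,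
    innerSL_apply_apply, h5, smul_eq_mul, PiLp.single_apply, if_true, Finset.sum_add_distrib, h6,
    Finset.sum_const, Finset.card_univ, Fintype.card_fin, nsmul_eq_mul, massKernel, radialDensity]
  ring

theorem continuous_massKernel (s : ℝ) : Continuous (massKernel s : Euc N → ℝ) :=
  continuous_const.mul ((continuous_radialDensity N).comp (by fun_prop))

theorem massKernel_nonneg {s : ℝ} (hs : 0 ≤ s) (z : Euc N) : 0 ≤ massKernel s z :=
  mul_nonneg (inv_nonneg.2 (pow_nonneg hs _)) (radialDensity_nonneg N (by positivity))

theorem massKernel_eq_zero {s : ℝ} (hs : 0 < s) {z : Euc N} (hz : s ≤ ‖z‖) :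
    massKernel s z = 0 := by
  rw [massKernel, radialDensity_of_one_le N, mul_zero]
  rw [one_le_div (by positivity)]
  gcongr

theorem massKernel_of_norm_le {s : ℝ} (hs : 0 < s) {z : Euc N} (hz : ‖z‖ ≤ s / 2) :
    massKernel s z = (s ^ N)⁻¹ * N := by
  rw [massKernel, radialDensity_of_lt N]
  rw [div_lt_iff₀ (by positivity)]
  nlinarith [norm_nonneg z]

theorem exists_massKernel_le (N : ℕ) :
    ∃ M : ℝ, 0 ≤ M ∧ ∀ s : ℝ, 0 < s → ∀ z : Euc N, massKernel s z ≤ M * (s ^ N)⁻¹ := by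
  obtain ⟨M, hM⟩ := isCompact_Icc.exists_bound_of_continuousOn (s := Icc (0 : ℝ) 1)
    (continuous_radialDensity N).continuousOn
  have hM0 : 0 ≤ M := (norm_nonneg _).trans (hM 0 (by simp))
  refine ⟨M, hM0, fun s hs z => ?_⟩
  rcases le_total s ‖z‖ with h | h
  · rw [massKernel_eq_zero hs h]
    positivity
  · rw [massKernel, mul_comm]
    gcongr
    refine (le_abs_self _).trans (hM _ ⟨by positivity, ?_⟩)
    rw [div_le_one (by positivity)]
    gcongr

theorem inv_pow_mul_rpow_norm {s : ℝ} (hs : 0 < s) {z : Euc N} (hz : z ≠ 0) :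
    (s ^ N)⁻¹ * (‖z‖ ^ 2 / s ^ 2) ^ (-(N : ℝ) / 2) = (‖z‖ ^ N)⁻¹ := by
  have hz0 : 0 < ‖z‖ := norm_pos_iff.2 hz
  rw [← div_pow, ← Real.rpow_natCast (‖z‖ / s) 2, ← Real.rpow_mul (by positivity)]
  rw [show ((2 : ℕ) : ℝ) * (-(N : ℝ) / 2) = -(N : ℝ) by push_cast; ring,
    Real.rpow_neg (by positivity), Real.rpow_natCast, div_pow]
  field_simp

theorem radialField_of_le_norm {s : ℝ} (hs : 0 < s) {z : Euc N} (hz : s ≤ ‖z‖) :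
    radialField s z = (‖z‖ ^ N)⁻¹ • z := by
  have hz0 : z ≠ 0 := norm_pos_iff.1 (hs.trans_le hz)
  rw [radialField, radialProfile_of_one_le N, inv_pow_mul_rpow_norm hs hz0]
  rw [one_le_div (by positivity)]
  gcongr

theorem norm_radialField_sub_le {s t : ℝ} (hs : 0 < s) (ht : 0 < t) (z : Euc N) :
    ‖radialField s z - radialField t z‖ ≤ (‖z‖ ^ N)⁻¹ * ‖z‖ := by
  rcases eq_or_ne z 0 with rfl | hz
  · simp [radialField]
  have hz0 : 0 < ‖z‖ := norm_pos_iff.2 hz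
  have key : ∀ s : ℝ, 0 < s → 0 ≤ (s ^ N)⁻¹ * radialProfile N (‖z‖ ^ 2 / s ^ 2) ∧
      (s ^ N)⁻¹ * radialProfile N (‖z‖ ^ 2 / s ^ 2) ≤ (‖z‖ ^ N)⁻¹ := by
    intro s hs
    refine ⟨mul_nonneg (by positivity) (radialProfile_nonneg N (by positivity)), ?_⟩
    rw [← inv_pow_mul_rpow_norm hs hz]
    gcongr
    exact radialProfile_le N (by positivity)
  rw [radialField, radialField, ← sub_smul, norm_smul]
  gcongr
  rw [Real.norm_eq_abs, abs_le]
  have h1 := key s hs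
  have h2 := key t ht
  constructor <;> linarith [h1.1, h1.2, h2.1, h2.2]

theorem hasCompactSupport_radialField_sub {s t : ℝ} (ht : 0 < t) (hts : t ≤ s) :
    HasCompactSupport (fun z : Euc N => radialField s z - radialField t z) := by
  refine HasCompactSupport.intro (isCompact_closedBall 0 s) fun z hz => ?_
  rw [mem_closedBall_zero_iff, not_le] at hz
  rw [radialField_of_le_norm (ht.trans_le hts) hz.le, radialField_of_le_norm ht (hts.trans hz.le),
    sub_self]

theorem trace_fderiv_radialField_sub (s t : ℝ) (z : Euc N) :
    LinearMap.trace ℝ (Euc N)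
      (fderiv ℝ (fun z : Euc N => radialField s z - radialField t z) z).toLinearMap =
      massKernel s z - massKernel t z := by
  have h : ∀ s : ℝ, DifferentiableAt ℝ (radialField s : Euc N → Euc N) z := fun s =>
    (contDiff_radialField s).differentiable (by simp) z
  rw [fderiv_fun_sub (h s) (h t), ← trace_fderiv_radialField, ← trace_fderiv_radialField,
    ContinuousLinearMap.toLinearMap_sub, map_sub]

theorem exists_integral_norm_radialField_sub_le (hN : 2 ≤ N) :
    ∃ C : ℝ, 0 < C ∧ ∀ t s : ℝ, 0 < t → t ≤ s →
      ∫ z : Euc N, ‖radialField s z - radialField t z‖ ≤ C * s := by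
  have : NeZero N := ⟨by omega⟩
  have : Nontrivial (Euc N) := Module.nontrivial_of_finrank_pos (R := ℝ) (by simp; omega)
  refine ⟨N * volume.real (Metric.ball (0 : Euc N) 1), ?_, fun t s ht hts => ?_⟩
  · have : 0 < volume.real (Metric.ball (0 : Euc N) 1) :=
      ENNReal.toReal_pos (Metric.measure_ball_pos _ _ one_pos).ne' measure_ball_lt_top.ne
    have : (0 : ℝ) < N := by exact_mod_cast (by omega : 0 < N)
    positivity
  have hs : 0 < s := ht.trans_le hts
  let φ : ℝ → ℝ := (Iic s).indicator fun r => (r ^ N)⁻¹ * r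
  have hφ : ∀ r ∈ Ioi (0 : ℝ), r ^ (N - 1) • φ r = (Iic s).indicator (fun _ => (1 : ℝ)) r := by
    intro r hr
    by_cases h : r ∈ Iic s
    · have hr0 : (r : ℝ) ≠ 0 := (mem_Ioi.1 hr).ne'
      simp only [φ, indicator_of_mem h, smul_eq_mul]
      rw [← pow_sub_one_mul (by omega : N ≠ 0)]
      field_simp
    · simp [φ, indicator_of_notMem h]
  have hi : Integrable (fun z : Euc N => φ ‖z‖) := by
    rw [integrable_fun_norm_addHaar volume (f := φ)]
    rw [finrank_euclideanSpace_fin]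
    refine (integrableOn_congr_fun hφ measurableSet_Ioi).2 ?_
    rw [IntegrableOn, integrable_indicator_iff measurableSet_Iic, IntegrableOn,
      Measure.restrict_restrict measurableSet_Iic, Iic_inter_Ioi]
    exact integrableOn_const (by simp)
  calc ∫ z : Euc N, ‖radialField s z - radialField t z‖ ≤ ∫ z : Euc N, φ ‖z‖ := by
        refine integral_mono_of_nonneg (.of_forall fun _ => norm_nonneg _) hi
          (.of_forall fun z => ?_)
        by_cases h : ‖z‖ ∈ Iic s
        · simpa [φ, indicator_of_mem h] using norm_radialField_sub_le hs ht z
        · have h1 : s < ‖z‖ := not_le.1 h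
          simp [φ, indicator_of_notMem h, radialField_of_le_norm hs h1.le,
            radialField_of_le_norm ht (hts.trans h1.le)]
    _ = N * volume.real (Metric.ball (0 : Euc N) 1) * s := by
        rw [integral_fun_norm_addHaar volume φ, finrank_euclideanSpace_fin,
          setIntegral_congr_fun measurableSet_Ioi hφ, integral_indicator measurableSet_Iic,
          Measure.restrict_restrict measurableSet_Iic, Iic_inter_Ioi]
        simp [hs.le, mul_assoc]

end MassKernel

section ConvolutionBound

variable {N : ℕ}

/-- The convolution of the indicator of a bounded set with a smooth field. -/
theorem exists_contDiff_trace_fderiv_eq_setIntegral {P : Set (Euc N)} (hP : MeasurableSet P)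
    (hPb : Bornology.IsBounded P) {G : Euc N → Euc N} (hG : ContDiff ℝ (⊤ : ℕ∞) G)
    (hGc : HasCompactSupport G) :
    ∃ T : Euc N → Euc N, ContDiff ℝ (⊤ : ℕ∞) T ∧ HasCompactSupport T ∧
      (∀ ξ, ‖T ξ‖ ≤ ∫ z, ‖G z‖) ∧
      ∀ ξ, LinearMap.trace ℝ (Euc N) (fderiv ℝ T ξ).toLinearMap =
        ∫ t in P, LinearMap.trace ℝ (Euc N) (fderiv ℝ G (ξ - t)).toLinearMap := by
  set p : Euc N → ℝ := P.indicator fun _ => 1 with hp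
  have hpi : LocallyIntegrable p :=
    (((integrable_indicator_iff hP).2
      (integrableOn_const hPb.measure_lt_top.ne)) : Integrable p volume).locallyIntegrable
  have hpc : HasCompactSupport p := by
    refine HasCompactSupport.of_support_subset_isCompact hPb.isCompact_closure ?_
    exact support_indicator_subset.trans subset_closure
  let L : ℝ →L[ℝ] Euc N →L[ℝ] Euc N := ContinuousLinearMap.lsmul ℝ ℝ
  have hGi : Integrable G := hG.continuous.integrable_of_hasCompactSupport hGc
  refine ⟨convolution p G L volume, hGc.contDiff_convolution_right L hpi hG,
    HasCompactSupport.convolution L hpc hGc, fun ξ => ?_, fun ξ => ?_⟩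
  · calc ‖convolution p G L volume ξ‖ ≤ ∫ t, ‖G (ξ - t)‖ := by
          refine norm_integral_le_of_norm_le (hGi.norm.comp_sub_left ξ) (.of_forall fun t => ?_)
          simp only [L, ContinuousLinearMap.lsmul_apply, norm_smul]
          refine mul_le_of_le_one_left (norm_nonneg _) ?_
          by_cases h : t ∈ P <;> simp [hp, h]
      _ = ∫ z, ‖G z‖ := integral_sub_left_eq_self (fun z => ‖G z‖) volume ξ
  · have h1 := hGc.hasFDerivAt_convolution_right L hpi (hG.of_le (by exact_mod_cast le_top)) ξ
    rw [h1.fderiv]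
    let τ : (Euc N →L[ℝ] Euc N) →L[ℝ] ℝ := LinearMap.toContinuousLinearMap
      ((LinearMap.trace ℝ (Euc N)).comp (ContinuousLinearMap.coeLM ℝ))
    have hτ : ∀ A : Euc N →L[ℝ] Euc N, τ A = LinearMap.trace ℝ (Euc N) A.toLinearMap :=
      fun _ => rfl
    have hex : ConvolutionExistsAt p (fderiv ℝ G) ξ (L.precompR (Euc N)) volume :=
      (hGc.fderiv ℝ).convolutionExists_right _ hpi (hG.continuous_fderiv (by simp)) ξ
    simp only [← hτ]
    rw [convolution, ← τ.integral_comp_comm hex, ← integral_indicator hP]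
    refine integral_congr_ae (.of_forall fun t => ?_)
    by_cases h : t ∈ P
    · simp only [hp, indicator_of_mem h]
      congr 1
      ext v
      simp [L, ContinuousLinearMap.precompR_apply]
    · simp only [hp, indicator_of_notMem h, map_zero, _root_.zero_apply]

theorem abs_integral_mul_setIntegral_trace_le {Ω : Set (Euc N)} {u : Euc N → Euc N}
    {c : Euc N → Matrix (Fin N) (Fin N) ℝ} {d : Euc N → ℝ} {S : ℝ}
    (hu : AEMeasurable u (volume.restrict Ω)) (hc : ∀ i j, IntegrableOn (fun x => c x i j) Ω)
    (hd : IntegrableOn d Ω)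
    (hS : ∀ η, TestFun Ω η → energyFunctional Ω u c d η ≤ S)
    {φ : Euc N → ℝ} (hφ : ContDiff ℝ (⊤ : ℕ∞) φ) (hφc : HasCompactSupport φ)
    (hφs : tsupport φ ⊆ Ω) (hφ1 : ∀ x, |φ x| ≤ 1) {C : ℝ}
    (hC : ∀ x j, |fderiv ℝ φ x (EuclideanSpace.single j 1)| ≤ C)
    {P : Set (Euc N)} (hP : MeasurableSet P) (hPb : Bornology.IsBounded P)
    {G : Euc N → Euc N} (hG : ContDiff ℝ (⊤ : ℕ∞) G) (hGc : HasCompactSupport G)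
    {K : ℝ} (hK : 0 < K) (hGK : ∫ z, ‖G z‖ ≤ K) :
    |∫ x in Ω, φ x * (∫ t in P, LinearMap.trace ℝ (Euc N)
      (fderiv ℝ G (u x - t)).toLinearMap) * d x| ≤
      K * (S + C * ∑ i, ∑ j, ∫ x in Ω, |c x i j|) := by
  obtain ⟨T, hT, hTc, hTK, hTd⟩ := exists_contDiff_trace_fderiv_eq_setIntegral hP hPb hG hGc
  simp only [← hTd]
  set η : Euc N × Euc N → Euc N := fun p => φ p.1 • T p.2 with hη
  have hηd : ContDiff ℝ (⊤ : ℕ∞) η := contDiff_smul_prod hφ hT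
  have hηc : HasCompactSupport η := hasCompactSupport_smul_prod hφc hTc
  have hηs : tsupport η ⊆ Ω ×ˢ univ :=
    (tsupport_smul_prod_subset φ T).trans (prod_mono hφs (subset_univ _))
  have hηK : ∀ p, ‖η p‖ ≤ K := fun p => by
    rw [hη, norm_smul]
    calc |φ p.1| * ‖T p.2‖ ≤ 1 * K := by
          gcongr
          · exact hφ1 _
          · exact (hTK _).trans hGK
      _ = K := one_mul K
  have h1 := abs_energyFunctional_le hS hηd hηc hηs hK hηK
  rw [energyFunctional, integral_add (integrableOn_frobInner hηd hηc hu hc)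
    (integrableOn_divXi_mul hηd hηc hu hd)] at h1
  simp only [hη, divXi_smul_prod hφ hT] at h1
  have h2 : |∫ x in Ω, frobInner (c x) (DxMatrix (fun p => φ p.1 • T p.2) x (u x))| ≤
      K * (C * ∑ i, ∑ j, ∫ x in Ω, |c x i j|) := by
    have hi : ∀ i j, IntegrableOn (fun x => |c x i j|) Ω := fun i j => (hc i j).abs
    calc |∫ x in Ω, frobInner (c x) (DxMatrix (fun p => φ p.1 • T p.2) x (u x))|
        ≤ ∫ x in Ω, ∑ i, ∑ j, |c x i j| * (C * K) := by
          rw [← Real.norm_eq_abs]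
          refine norm_integral_le_of_norm_le (integrable_finsetSum _ fun i _ =>
            integrable_finsetSum _ fun j _ => (hi i j).mul_const (C * K)) (.of_forall fun x => ?_)
          rw [frobInner_DxMatrix_smul_prod hφ hT, Real.norm_eq_abs]
          refine (Finset.abs_sum_le_sum_abs _ _).trans (Finset.sum_le_sum fun i _ => ?_)
          refine (Finset.abs_sum_le_sum_abs _ _).trans (Finset.sum_le_sum fun j _ => ?_)
          rw [abs_mul, abs_mul]
          have h3 : |T (u x) i| ≤ K := by
            have := PiLp.norm_apply_le (p := 2) (T (u x)) i
            exact this.trans ((hTK _).trans hGK)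
          have h4 := hC x j
          have : 0 ≤ C := (abs_nonneg _).trans h4
          gcongr
      _ = K * (C * ∑ i, ∑ j, ∫ x in Ω, |c x i j|) := by
          rw [integral_finsetSum _ fun i _ => integrable_finsetSum _ fun j _ => (hi i j).mul_const _]
          simp only [Finset.mul_sum]
          refine Finset.sum_congr rfl fun i _ => ?_
          rw [integral_finsetSum _ fun j _ => (hi i j).mul_const _]
          refine Finset.sum_congr rfl fun j _ => ?_
          rw [integral_mul_const]
          ring
  rw [abs_le] at *
  constructor <;> linarith [h1.1, h1.2, h2.1, h2.2]

end ConvolutionBound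

section MassPotential

variable {N : ℕ}

/-- The mollified mass of `P` near `ξ` at scale `s`. -/
def massPotential (P : Set (Euc N)) (s : ℝ) (ξ : Euc N) : ℝ :=
  ∫ t in P, massKernel s (ξ - t)

theorem hasCompactSupport_massKernel {s : ℝ} (hs : 0 < s) :
    HasCompactSupport (massKernel s : Euc N → ℝ) :=
  HasCompactSupport.intro (isCompact_closedBall 0 s) fun z hz => massKernel_eq_zero hs
    (by rw [mem_closedBall_zero_iff, not_le] at hz; exact hz.le)

theorem integrable_massKernel_sub {s : ℝ} (hs : 0 < s) (ξ : Euc N) :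
    Integrable fun t => massKernel s (ξ - t) :=
  ((continuous_massKernel s).integrable_of_hasCompactSupport
    (hasCompactSupport_massKernel hs)).comp_sub_left ξ

theorem massPotential_nonneg (P : Set (Euc N)) {s : ℝ} (hs : 0 < s) (ξ : Euc N) :
    0 ≤ massPotential P s ξ :=
  integral_nonneg fun _ => massKernel_nonneg hs.le _

theorem measurable_massPotential (P : Set (Euc N)) (s : ℝ) : Measurable (massPotential P s) := by
  have h : Continuous fun p : Euc N × Euc N => massKernel s (p.1 - p.2) :=
    (continuous_massKernel s).comp (by fun_prop)
  exact (h.stronglyMeasurable.integral_prod_right (ν := volume.restrict P)).measurable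

theorem exists_massPotential_le (N : ℕ) : ∃ M : ℝ, 0 ≤ M ∧
    ∀ (P : Set (Euc N)) (s : ℝ), 0 < s → ∀ ξ : Euc N, massPotential P s ξ ≤
      M * (volume.real (P ∩ Metric.closedBall ξ s) / volume.real (Metric.closedBall ξ s)) := by
  obtain ⟨M, hM0, hM⟩ := exists_massKernel_le N
  refine ⟨M * volume.real (Metric.ball (0 : Euc N) 1), by positivity, fun P s hs ξ => ?_⟩
  have hV : 0 < volume.real (Metric.ball (0 : Euc N) 1) :=
    ENNReal.toReal_pos (Metric.measure_ball_pos _ _ one_pos).ne' measure_ball_lt_top.ne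
  calc massPotential P s ξ
      ≤ ∫ t in P, (Metric.closedBall ξ s).indicator (fun _ => M * (s ^ N)⁻¹) t := by
        refine integral_mono (integrable_massKernel_sub hs ξ).integrableOn ?_ fun t => ?_
        · rw [integrable_indicator_iff measurableSet_closedBall]
          refine integrableOn_const ?_
          exact ((Measure.restrict_apply_le _ _).trans_lt measure_closedBall_lt_top).ne
        · by_cases h : t ∈ Metric.closedBall ξ s
          · simpa [indicator_of_mem h] using hM s hs (ξ - t)
          · rw [indicator_of_notMem h]
            rw [Metric.mem_closedBall, not_le, dist_comm, dist_eq_norm] at h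
            exact (massKernel_eq_zero hs h.le).le
    _ = volume.real (P ∩ Metric.closedBall ξ s) * (M * (s ^ N)⁻¹) := by
        rw [integral_indicator measurableSet_closedBall, setIntegral_const, smul_eq_mul,
          measureReal_restrict_apply measurableSet_closedBall, inter_comm]
    _ = _ := by
        rw [Measure.addHaar_real_closedBall _ _ hs.le, finrank_euclideanSpace_fin]
        field_simp

theorem exists_massPotential_le_const (N : ℕ) : ∃ M : ℝ, 0 ≤ M ∧
    ∀ (P : Set (Euc N)) (s : ℝ), 0 < s → ∀ ξ : Euc N, massPotential P s ξ ≤ M := by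
  obtain ⟨M, hM0, hM⟩ := exists_massPotential_le N
  refine ⟨M, hM0, fun P s hs ξ => (hM P s hs ξ).trans (mul_le_of_le_one_right hM0 ?_)⟩
  exact div_le_one_of_le₀ (measureReal_mono inter_subset_right measure_closedBall_lt_top.ne)
    measureReal_nonneg

theorem ae_tendsto_massPotential_zero {P : Set (Euc N)} (hP : MeasurableSet P) :
    ∀ᵐ ξ, ξ ∉ P → Tendsto (fun s => massPotential P s ξ) (𝓝[>] 0) (𝓝 0) := by
  obtain ⟨M, -, hM⟩ := exists_massPotential_le N
  filter_upwards [Besicovitch.ae_tendsto_measure_inter_div_of_measurableSet volume hP]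
    with ξ hξ hξP
  rw [indicator_of_notMem hξP] at hξ
  have h := ((ENNReal.tendsto_toReal ENNReal.zero_ne_top).comp hξ).const_mul M
  rw [ENNReal.toReal_zero, mul_zero] at h
  refine squeeze_zero' ?_ ?_ h
  · filter_upwards [self_mem_nhdsWithin] with s hs using massPotential_nonneg P hs ξ
  · filter_upwards [self_mem_nhdsWithin] with s hs
    simpa [measureReal_def, ENNReal.toReal_div] using hM P s hs ξ

theorem tendsto_massPotential_inter_ball {P : Set (Euc N)} (hP : MeasurableSet P) {s : ℝ}
    (hs : 0 < s) (ξ : Euc N) :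
    Tendsto (fun k : ℕ => massPotential (P ∩ Metric.ball 0 k) s ξ) atTop
      (𝓝 (massPotential P s ξ)) := by
  have h : P = ⋃ k : ℕ, P ∩ Metric.ball 0 k := by
    rw [← inter_iUnion, Metric.iUnion_ball_nat, inter_univ]
  have h2 := tendsto_setIntegral_of_monotone (μ := volume) (f := fun t => massKernel s (ξ - t))
    (s := fun k : ℕ => P ∩ Metric.ball 0 k) (fun k => hP.inter measurableSet_ball)
    (fun a b hab => inter_subset_inter_right _ (Metric.ball_subset_ball (by exact_mod_cast hab)))
    (integrable_massKernel_sub hs ξ).integrableOn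
  rwa [← h] at h2

end MassPotential

section AdmissibleMap

variable {N : ℕ} {Ω D : Set (Euc N)} {u : Euc N → Euc N} {f : Euc N → Euc N →L[ℝ] Euc N}

theorem AdmissibleDef.ae_notMem_of_null (h : AdmissibleDef Ω D u f) (hΩ : MeasurableSet Ω)
    {E : Set (Euc N)} (hE : volume E = 0) : ∀ᵐ x ∂volume.restrict Ω, u x ∉ E := by
  obtain ⟨htri, hinj, hdet, -⟩ := h
  set F := toMeasurable volume E with hF
  have hFm : MeasurableSet F := measurableSet_toMeasurable _ _
  have hF0 : volume F = 0 := by rw [hF, measure_toMeasurable, hE]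
  have hui : AEMeasurable (fun x => F.indicator (1 : Euc N → ℝ≥0∞) (u x)) (volume.restrict D) :=
    (measurable_one.indicator hFm).comp_aemeasurable
      (htri.aemeasurable.mono_measure (Measure.restrict_mono htri.2.1 le_rfl))
  have h1 := lintegral_image_eq_lintegral_abs_det_fderiv_mul volume htri.1 htri.2.2.2 hinj
    (F.indicator 1)
  have h2 : ∫⁻ x in u '' D, F.indicator 1 x = 0 := by
    rw [lintegral_indicator_one hFm]
    exact le_antisymm ((Measure.restrict_apply_le _ _).trans hF0.le) bot_le
  rw [h2, eq_comm] at h1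
  have h1 := (lintegral_eq_zero_iff'
    ((aemeasurable_ofReal_abs_det_fderivWithin volume htri.1 htri.2.2.2).mul hui)).1 h1
  rw [EventuallyEq, ae_restrict_iff' htri.1] at h1
  filter_upwards [htri.ae_mem hΩ, ae_restrict_of_ae h1] with x hxD hx hxE
  have hx := hx hxD
  have hxF : u x ∈ F := subset_toMeasurable _ _ hxE
  simp [indicator_of_mem hxF, (hdet x hxD).ne'] at hx

theorem aestronglyMeasurable_mul_massPotential_mul (hu : AEMeasurable u (volume.restrict Ω))
    {φ d : Euc N → ℝ} (hφ : Continuous φ) (hd : IntegrableOn d Ω) (P : Set (Euc N)) (s : ℝ) :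
    AEStronglyMeasurable (fun x => φ x * massPotential P s (u x) * d x) (volume.restrict Ω) :=
  (hφ.aestronglyMeasurable.mul
    ((measurable_massPotential P s).comp_aemeasurable hu).aestronglyMeasurable).mul hd.1

theorem abs_mul_massPotential_mul_le {φ : Euc N → ℝ} (hφ1 : ∀ x, |φ x| ≤ 1) {M : ℝ}
    (hM : ∀ (P : Set (Euc N)) (s : ℝ), 0 < s → ∀ ξ : Euc N, massPotential P s ξ ≤ M)
    (P : Set (Euc N)) {s : ℝ} (hs : 0 < s) (x ξ : Euc N) (d : ℝ) :
    ‖φ x * massPotential P s ξ * d‖ ≤ M * |d| := by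
  have h1 := massPotential_nonneg P hs ξ
  rw [norm_mul, norm_mul, Real.norm_eq_abs, Real.norm_eq_abs, Real.norm_eq_abs, abs_of_nonneg h1]
  gcongr
  exact (mul_le_of_le_one_left h1 (hφ1 x)).trans (hM P s hs ξ)

theorem AdmissibleDef.exists_abs_integral_massPotential_le (hN : 2 ≤ N) :
    ∃ K : ℝ, 0 < K ∧ ∀ {Ω D : Set (Euc N)} {u : Euc N → Euc N} {f : Euc N → Euc N →L[ℝ] Euc N},
    AdmissibleDef Ω D u f → MeasurableSet Ω →
    (∀ i j, IntegrableOn (fun x => cofCLM (f x) i j) Ω) → ∀ {S : ℝ},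
    (∀ η, TestFun Ω η → SEta Ω u f η ≤ S) →
    ∀ {φ : Euc N → ℝ}, ContDiff ℝ (⊤ : ℕ∞) φ → HasCompactSupport φ →
    tsupport φ ⊆ Ω → (∀ x, |φ x| ≤ 1) → ∀ {C : ℝ},
    (∀ x j, |fderiv ℝ φ x (EuclideanSpace.single j 1)| ≤ C) →
    ∀ {P : Set (Euc N)}, MeasurableSet P → (∀ x ∈ D, φ x ≠ 0 → u x ∉ P) →
    ∀ {s : ℝ}, 0 < s → |∫ x in Ω, φ x * massPotential P s (u x) * (f x).det| ≤
      K * s * (S + C * ∑ i, ∑ j, ∫ x in Ω, |cofCLM (f x) i j|) := by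
  obtain ⟨K, hK, hKi⟩ := exists_integral_norm_radialField_sub_le hN
  obtain ⟨M, hM0, hM⟩ := exists_massPotential_le_const N
  refine ⟨K, hK, fun {Ω D u f} hadm hΩ hcof {S} hS {φ} hφ hφc hφs hφ1 {C} hC {P} hP hPu {s} hs => ?_⟩
  set B := S + C * ∑ i, ∑ j, ∫ x in Ω, |cofCLM (f x) i j| with hB
  have hu := hadm.1.aemeasurable
  have hd := hadm.2.2.2
  have hmeas := aestronglyMeasurable_mul_massPotential_mul hu hφ.continuous hd
  have hbd : ∀ (P : Set (Euc N)) (s : ℝ), 0 < s → ∀ᵐ x ∂volume.restrict Ω,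
      ‖φ x * massPotential P s (u x) * (f x).det‖ ≤ M * |(f x).det| := fun P s hs =>
    .of_forall fun x => abs_mul_massPotential_mul_le hφ1 hM P hs x (u x) (f x).det
  have hbi : Integrable (fun x => M * |(f x).det|) (volume.restrict Ω) := hd.abs.const_mul M
  have bounded : ∀ {P : Set (Euc N)}, MeasurableSet P → Bornology.IsBounded P →
      (∀ x ∈ D, φ x ≠ 0 → u x ∉ P) →
      |∫ x in Ω, φ x * massPotential P s (u x) * (f x).det| ≤ K * s * B := by
    intro P hP hPb hPu
    have hlim : Tendsto (fun t => ∫ x in Ω, φ x * massPotential P t (u x) * (f x).det)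
        (𝓝[>] 0) (𝓝 0) := by
      have h1 := tendsto_integral_filter_of_dominated_convergence (l := 𝓝[>] (0 : ℝ))
        (F := fun t x => φ x * massPotential P t (u x) * (f x).det) (f := fun _ => 0)
        _ (.of_forall fun t => hmeas P t)
        (by filter_upwards [self_mem_nhdsWithin] with t ht using hbd P t ht) hbi ?_
      · simpa using h1
      filter_upwards [hadm.1.ae_mem hΩ, hadm.ae_notMem_of_null hΩ
        (ae_iff.1 (ae_tendsto_massPotential_zero hP))] with x hxD hx
      by_cases h0 : φ x = 0
      · simp [h0]
      · have h2 := not_not.1 hx (hPu x hxD h0)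
        simpa using (h2.const_mul (φ x)).mul_const (f x).det
    have hlim2 : Tendsto (fun t => |∫ x in Ω, φ x * massPotential P t (u x) * (f x).det| +
        K * s * B) (𝓝[>] 0) (𝓝 (K * s * B)) := by
      simpa using hlim.abs.add_const (K * s * B)
    refine ge_of_tendsto hlim2 ?_
    filter_upwards [Ioc_mem_nhdsGT hs] with t ht
    have h3 := abs_integral_mul_setIntegral_trace_le hu hcof hd hS hφ hφc hφs hφ1 hC hP hPb
      ((contDiff_radialField s).sub (contDiff_radialField t))
      (hasCompactSupport_radialField_sub ht.1 ht.2) (by positivity) (hKi t s ht.1 ht.2)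
    simp only [trace_fderiv_radialField_sub] at h3
    have h4 : ∀ ξ, ∫ z in P, (massKernel s (ξ - z) - massKernel t (ξ - z)) =
        massPotential P s ξ - massPotential P t ξ := fun ξ =>
      integral_sub (integrable_massKernel_sub hs ξ).integrableOn
        (integrable_massKernel_sub ht.1 ξ).integrableOn
    simp only [h4, mul_sub, sub_mul] at h3
    rw [integral_sub (hbi.mono' (hmeas P s) (hbd P s hs))
      (hbi.mono' (hmeas P t) (hbd P t ht.1))] at h3
    have h5 := abs_sub_abs_le_abs_sub (∫ x in Ω, φ x * massPotential P s (u x) * (f x).det)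
      (∫ x in Ω, φ x * massPotential P t (u x) * (f x).det)
    linarith
  have hk := tendsto_integral_of_dominated_convergence
    (F := fun (k : ℕ) x => φ x * massPotential (P ∩ Metric.ball 0 k) s (u x) * (f x).det)
    _ (fun k => hmeas _ s) hbi (fun k => hbd _ s hs)
    (.of_forall fun x =>
      ((tendsto_massPotential_inter_ball hP hs (u x)).const_mul (φ x)).mul_const _)
  exact le_of_tendsto hk.abs (.of_forall fun k => bounded (hP.inter measurableSet_ball)
    (Metric.isBounded_ball.subset inter_subset_right) fun x hx h0 hxP => hPu x hx h0 hxP.1)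

theorem AdmissibleDef.massPotential_image (h : AdmissibleDef Ω D u f)
    {A : Set (Euc N)} (hA : MeasurableSet A) (hAΩ : A ⊆ Ω) (s : ℝ) (ξ : Euc N) :
    massPotential (u '' (D ∩ A)) s ξ = ∫ x in A, massKernel s (ξ - u x) * (f x).det := by
  obtain ⟨htri, hinj, hdet, -⟩ := h
  rw [massPotential, integral_image_eq_integral_abs_det_fderiv_smul volume (htri.1.inter hA)
    (fun x hx => (htri.2.2.2 x hx.1).mono inter_subset_left) (hinj.mono inter_subset_left)]
  have h1 : (D ∩ A : Set (Euc N)) =ᵐ[volume] A := by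
    rw [ae_eq_set]
    refine ⟨by simp [sdiff_eq_empty.2 (inter_subset_right : D ∩ A ⊆ A)], ?_⟩
    have h2 : A \ (D ∩ A) ⊆ Ω \ D := fun x hx => ⟨hAΩ hx.1, fun hD => hx.2 ⟨hD, hx.1⟩⟩
    exact measure_mono_null h2 htri.2.2.1
  rw [setIntegral_congr_fun (htri.1.inter hA) (g := fun x => massKernel s (ξ - u x) * (f x).det)
    (fun x hx => by simp only [abs_of_pos (hdet x hx.1), smul_eq_mul, mul_comm])]
  exact setIntegral_congr_set h1

theorem AdmissibleDef.measurableSet_image (h : AdmissibleDef Ω D u f) {A : Set (Euc N)}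
    (hA : MeasurableSet A) : MeasurableSet (u '' (D ∩ A)) :=
  measurable_image_of_fderivWithin (h.1.1.inter hA)
    (fun x hx => (h.1.2.2.2 x hx.1).mono inter_subset_left) (h.2.1.mono inter_subset_left)

/-- The images of two disjoint parts of the domain do not accumulate mass near each other,
quantitatively in terms of the surface energy. -/
theorem AdmissibleDef.exists_abs_integral_massKernel_le (hN : 2 ≤ N) :
    ∃ K : ℝ, 0 < K ∧ ∀ {Ω D : Set (Euc N)} {u : Euc N → Euc N} {f : Euc N → Euc N →L[ℝ] Euc N},
    AdmissibleDef Ω D u f → MeasurableSet Ω →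
    (∀ i j, IntegrableOn (fun x => cofCLM (f x) i j) Ω) → ∀ {S : ℝ},
    (∀ η, TestFun Ω η → SEta Ω u f η ≤ S) →
    ∀ {φ : Euc N → ℝ}, ContDiff ℝ (⊤ : ℕ∞) φ → HasCompactSupport φ →
    tsupport φ ⊆ Ω → (∀ x, |φ x| ≤ 1) → ∀ {C : ℝ},
    (∀ x j, |fderiv ℝ φ x (EuclideanSpace.single j 1)| ≤ C) →
    ∀ {A : Set (Euc N)}, MeasurableSet A → A ⊆ Ω → (∀ x ∈ A, φ x = 0) →
    ∀ {s : ℝ}, 0 < s →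
    |∫ x in Ω, φ x * (∫ z in A, massKernel s (u x - u z) * (f z).det) * (f x).det| ≤
      K * s * (S + C * ∑ i, ∑ j, ∫ x in Ω, |cofCLM (f x) i j|) := by
  obtain ⟨K, hK, hle⟩ := AdmissibleDef.exists_abs_integral_massPotential_le hN
  refine ⟨K, hK, fun {Ω D u f} hadm hΩ hcof {S} hS {φ} hφ hφc hφs hφ1 {C} hC {A} hA hAΩ hφA {s} hs => ?_⟩
  simp only [← hadm.massPotential_image hA hAΩ]
  refine hle hadm hΩ hcof hS hφ hφc hφs hφ1 hC (hadm.measurableSet_image hA) ?_ hs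
  rintro x hx h0 ⟨z, ⟨hzD, hzA⟩, hzx⟩
  exact h0 (hadm.2.1 hzD hx hzx ▸ hφA z hzA)

end AdmissibleMap

section MassKernelLimit

variable {N : ℕ} {Ω : Set (Euc N)}

theorem tendsto_integral_massKernel [IsFiniteMeasure (volume.restrict Ω)]
    {us : ℕ → Euc N → Euc N} {D : ℕ → Set (Euc N)} {fs : ℕ → Euc N → Euc N →L[ℝ] Euc N}
    (hadm : ∀ n, AdmissibleDef Ω (D n) (us n) (fs n)) {u : Euc N → Euc N} {θ : Euc N → ℝ}
    {B : ℝ} (hB : ∀ᶠ n in atTop, ∫ x in Ω, |(fs n x).det| ≤ B)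
    (hdet : WeakL1ConvOn Ω (fun n x => (fs n x).det) θ)
    (hae : ∀ᵐ x ∂(volume.restrict Ω), Tendsto (fun n => us n x) atTop (𝓝 (u x)))
    {φ : Euc N → ℝ} (hφ : Continuous φ) (hφ1 : ∀ x, |φ x| ≤ 1)
    {A : Set (Euc N)} (hA : MeasurableSet A) (hAΩ : A ⊆ Ω) {s : ℝ} (hs : 0 < s) :
    Tendsto (fun n => ∫ x in Ω, φ x *
      (∫ z in A, massKernel s (us n x - us n z) * (fs n z).det) * (fs n x).det) atTop
      (𝓝 (∫ x in Ω, φ x * (∫ z in A, massKernel s (u x - u z) * θ z) * θ x)) := by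
  obtain ⟨M, hM0, hM⟩ := exists_massKernel_le N
  obtain ⟨M', hM'0, hM'⟩ := exists_massPotential_le_const N
  have hd : ∀ n, IntegrableOn (fun x => (fs n x).det) Ω := fun n => (hadm n).2.2.2
  have hinner : ∀ (v : Euc N → Euc N) (d : Euc N → ℝ) (x : Euc N),
      ∫ z in A, massKernel s (v x - v z) * d z =
        ∫ z in Ω, d z * A.indicator (fun z => massKernel s (v x - v z)) z := by
    intro v d x
    have h0 : (fun z => d z * A.indicator (fun z => massKernel s (v x - v z)) z) =
        A.indicator fun z => massKernel s (v x - v z) * d z := by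
      ext z
      by_cases hz : z ∈ A <;> simp [hz, mul_comm]
    rw [h0, setIntegral_indicator hA, inter_eq_right.2 hAΩ]
  have hpot : ∀ n x, ∫ z in A, massKernel s (us n x - us n z) * (fs n z).det =
      massPotential (us n '' (D n ∩ A)) s (us n x) := fun n x =>
    ((hadm n).massPotential_image hA hAΩ s (us n x)).symm
  have h1 : ∀ᵐ x ∂volume.restrict Ω, Tendsto
      (fun n => ∫ z in A, massKernel s (us n x - us n z) * (fs n z).det) atTop
      (𝓝 (∫ z in A, massKernel s (u x - u z) * θ z)) := by
    filter_upwards [hae] with x hx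
    simp only [hinner]
    refine tendsto_integral_mul_of_weak_of_ae (M := M * (s ^ N)⁻¹) hd hdet hB (fun n => ?_)
      (fun n => .of_forall fun z => ?_) ?_
    · exact ((continuous_massKernel s).measurable.comp_aemeasurable
        (aemeasurable_const.sub (hadm n).1.aemeasurable)).aestronglyMeasurable.indicator hA
    · by_cases hz : z ∈ A
      · rw [indicator_of_mem hz, abs_of_nonneg (massKernel_nonneg hs.le _)]
        exact hM s hs _
      · rw [indicator_of_notMem hz, abs_zero]
        positivity
    · filter_upwards [hae] with z hz
      by_cases hzA : z ∈ A
      · simp only [indicator_of_mem hzA]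
        exact ((continuous_massKernel s).tendsto _).comp (hx.sub hz)
      · simp [indicator_of_notMem hzA]
  have h2 := tendsto_integral_mul_of_weak_of_ae (M := M') hd hdet hB
    (g := fun n x => φ x * ∫ z in A, massKernel s (us n x - us n z) * (fs n z).det)
    (g₀ := fun x => φ x * ∫ z in A, massKernel s (u x - u z) * θ z) (fun n => ?_)
    (fun n => .of_forall fun x => ?_) (h1.mono fun x hx => hx.const_mul _)
  · simpa only [mul_comm _ (θ _), mul_comm _ (fs _ _).det] using h2
  · simp only [hpot]
    exact hφ.aestronglyMeasurable.mul ((measurable_massPotential _ s).comp_aemeasurable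
      (hadm n).1.aemeasurable).aestronglyMeasurable
  · have h3 := massPotential_nonneg (us n '' (D n ∩ A)) hs (us n x)
    rw [hpot, abs_mul, abs_of_nonneg h3]
    exact (mul_le_of_le_one_left h3 (hφ1 x)).trans (hM' _ s hs _)

end MassKernelLimit

section Separation

variable {N : ℕ} {Ω : Set (Euc N)} {u : Euc N → Euc N} {θ : Euc N → ℝ}

theorem ae_not_eventually_le_integral_massKernel
    (hu : AEMeasurable u (volume.restrict Ω)) (hθ : IntegrableOn θ Ω)
    (hθ0 : ∀ᵐ x ∂volume.restrict Ω, 0 < θ x) {φ : Euc N → ℝ} (hφ : Continuous φ)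
    (hφ0 : ∀ x, 0 ≤ φ x) (hφ1 : ∀ x, |φ x| ≤ 1) {A : Set (Euc N)} (hAΩ : A ⊆ Ω) {B : ℝ}
    (hB : ∀ s : ℝ, 0 < s →
      |∫ x in Ω, φ x * (∫ z in A, massKernel s (u x - u z) * θ z) * θ x| ≤ B * s) :
    ∀ᵐ z ∂volume.restrict A, ∀ c : ℝ, 0 < c →
      ¬ ∀ᶠ s in 𝓝[>] (0 : ℝ), c ≤ ∫ x in Ω, φ x * massKernel s (u x - u z) * θ x := by
  obtain ⟨M, hM0, hM⟩ := exists_massKernel_le N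
  have hAr : volume.restrict A ≤ volume.restrict Ω := Measure.restrict_mono hAΩ le_rfl
  have hθA : IntegrableOn θ A := hθ.mono_set hAΩ
  have hprod : ∀ s : ℝ, 0 < s → Integrable (Function.uncurry fun x z =>
      (φ x * massKernel s (u x - u z)) * (θ x * θ z))
      ((volume.restrict Ω).prod (volume.restrict A)) := by
    intro s hs
    refine (hθ.mul_prod hθA).bdd_mul (c := M * (s ^ N)⁻¹) ?_ (.of_forall fun p => ?_)
    · exact (hφ.comp continuous_fst).aestronglyMeasurable.mul
        ((continuous_massKernel s).measurable.comp_aemeasurable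
          (hu.comp_fst.sub (hu.mono_measure hAr).comp_snd)).aestronglyMeasurable
    · rw [norm_mul, Real.norm_eq_abs, Real.norm_eq_abs, abs_of_nonneg (massKernel_nonneg hs.le _)]
      exact (mul_le_of_le_one_left (massKernel_nonneg hs.le _) (hφ1 _)).trans (hM s hs _)
  set F : ℝ → Euc N → ℝ := fun s z => (∫ x in Ω, φ x * massKernel s (u x - u z) * θ x) * θ z
    with hF
  have hFe : ∀ s z, F s z = ∫ x in Ω, (φ x * massKernel s (u x - u z)) * (θ x * θ z) := by
    intro s z
    simp only [hF, ← integral_mul_const, mul_assoc]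
  have hFi : ∀ s : ℝ, 0 < s → Integrable (F s) (volume.restrict A) := by
    intro s hs
    have h1 := (hprod s hs).integral_prod_right
    exact h1.congr (.of_forall fun z => (hFe s z).symm)
  have hF0 : ∀ s : ℝ, 0 < s → ∀ᵐ z ∂volume.restrict A, 0 ≤ F s z := by
    intro s hs
    filter_upwards [hθ0.filter_mono (ae_mono hAr)] with z hz
    refine mul_nonneg (integral_nonneg_of_ae ?_) hz.le
    filter_upwards [hθ0] with x hx
    exact mul_nonneg (mul_nonneg (hφ0 x) (massKernel_nonneg hs.le _)) hx.le
  have hFle : ∀ s : ℝ, 0 < s → ∫ z in A, F s z ≤ B * s := by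
    intro s hs
    refine le_trans (le_of_eq ?_) ((le_abs_self _).trans (hB s hs))
    simp only [hFe]
    rw [← integral_integral_swap (hprod s hs)]
    refine integral_congr_ae (.of_forall fun x => ?_)
    simp only []
    rw [mul_right_comm, ← integral_const_mul]
    refine integral_congr_ae (.of_forall fun z => ?_)
    simp only []
    ring
  have hs : ∀ k : ℕ, (0 : ℝ) < 1 / ((k : ℝ) + 1) := fun k => by positivity
  have hlim : TendstoInMeasure (volume.restrict A) (fun (k : ℕ) => F (1 / ((k : ℝ) + 1)))
      atTop (fun _ => 0) := by
    refine tendstoInMeasure_of_tendsto_eLpNorm one_ne_zero (fun k => (hFi _ (hs k)).1)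
      aestronglyMeasurable_const ?_
    have h1 : Tendsto (fun k : ℕ => ENNReal.ofReal (B * (1 / ((k : ℝ) + 1)))) atTop (𝓝 0) := by
      have := ENNReal.tendsto_ofReal
        ((tendsto_one_div_add_atTop_nhds_zero_nat (𝕜 := ℝ)).const_mul B)
      simpa using this
    refine tendsto_of_tendsto_of_tendsto_of_le_of_le tendsto_const_nhds h1
      (fun _ => bot_le) fun k => ?_
    have h2 : (fun z => F (1 / ((k : ℝ) + 1)) z) - (fun _ => (0 : ℝ)) = F (1 / ((k : ℝ) + 1)) := by
      ext z
      simp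
    simp only [h2]
    rw [eLpNorm_one_eq_lintegral_enorm, ← ofReal_integral_norm_eq_lintegral_enorm (hFi _ (hs k))]
    refine ENNReal.ofReal_le_ofReal (le_trans (le_of_eq ?_) (hFle _ (hs k)))
    refine integral_congr_ae ?_
    filter_upwards [hF0 _ (hs k)] with z hz
    exact Real.norm_of_nonneg hz
  obtain ⟨ns, hns, hz⟩ := hlim.exists_seq_tendsto_ae
  filter_upwards [hz, hθ0.filter_mono (ae_mono hAr)] with z hz hz0 c hc hev
  have h1 : Tendsto (fun k : ℕ => 1 / ((ns k : ℝ) + 1)) atTop (𝓝[>] 0) :=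
    (tendsto_nhdsWithin_iff.2 ⟨tendsto_one_div_add_atTop_nhds_zero_nat (𝕜 := ℝ),
      .of_forall fun k => hs k⟩).comp hns.tendsto_atTop
  have h2 : c * θ z ≤ 0 := by
    refine ge_of_tendsto hz ?_
    filter_upwards [h1.eventually hev] with k hk
    exact mul_le_mul_of_nonneg_right hk hz0.le
  exact absurd h2 (not_le.2 (mul_pos hc hz0))

theorem exists_eventually_le_integral_massKernel (hN : 0 < N) (hΩ : IsOpen Ω) {D : Set (Euc N)}
    {f : Euc N → Euc N →L[ℝ] Euc N} (htri : ApproxDiffTriple Ω D u f) (hθ : IntegrableOn θ Ω)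
    (hθ0 : ∀ᵐ x ∂volume.restrict Ω, 0 < θ x) {φ : Euc N → ℝ} (hφ : Continuous φ)
    (hφ0 : ∀ x, 0 ≤ φ x) (hφ1 : ∀ x, |φ x| ≤ 1) {x : Euc N} (hxD : x ∈ D) (hx0 : 0 < θ x)
    (hx : Tendsto (fun r : ℝ => (r ^ N)⁻¹ * ∫ w in Metric.closedBall x r, |θ w - θ x|)
      (𝓝[>] 0) (𝓝 0))
    (hφx : ∀ᶠ w in 𝓝 x, φ w = 1) :
    ∃ c : ℝ, 0 < c ∧
      ∀ᶠ s in 𝓝[>] (0 : ℝ), c ≤ ∫ w in Ω, φ w * massKernel s (u w - u x) * θ w := by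
  obtain ⟨M, hM0, hM⟩ := exists_massKernel_le N
  have hV : 0 < volume.real (Metric.ball (0 : Euc N) 1) :=
    ENNReal.toReal_pos (Metric.measure_ball_pos _ _ one_pos).ne' measure_ball_lt_top.ne
  set V := volume.real (Metric.ball (0 : Euc N) 1) with hVdef
  obtain ⟨L, hL, hLu⟩ := ((htri.2.2.2 x hxD).isBigO_sub).exists_pos
  rw [Asymptotics.isBigOWith_iff, eventually_nhdsWithin_iff] at hLu
  obtain ⟨ρ, hρ, hball⟩ := Metric.eventually_nhds_iff_ball.1
    (hLu.and (hφx.and (hΩ.mem_nhds (htri.2.1 hxD))))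
  have hNR : (0 : ℝ) < N := by exact_mod_cast hN
  refine ⟨N * ((2 * L) ^ N)⁻¹ * (V * θ x / 2), by positivity, ?_⟩
  have hr : Tendsto (fun s : ℝ => s / (2 * L)) (𝓝[>] 0) (𝓝[>] 0) := by
    refine tendsto_nhdsWithin_iff.2 ⟨?_, ?_⟩
    · have : Tendsto (fun s : ℝ => s / (2 * L)) (𝓝 0) (𝓝 (0 / (2 * L))) :=
        tendsto_id.div_const _
      rw [zero_div] at this
      exact this.mono_left nhdsWithin_le_nhds
    · filter_upwards [self_mem_nhdsWithin] with s hs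
      have hs : 0 < s := hs
      exact mem_Ioi.2 (by positivity)
  filter_upwards [self_mem_nhdsWithin, hr.eventually (hx.eventually_lt_const
    (show 0 < V * θ x / 2 by positivity)), hr.eventually (Ioo_mem_nhdsGT hρ)] with s hs h1 h2
  have hs : 0 < s := hs
  set r := s / (2 * L) with hrdef
  have hr0 : 0 < r := h2.1
  have hsub : Metric.closedBall x r ⊆ Metric.ball x ρ := Metric.closedBall_subset_ball h2.2
  have hsubΩ : Metric.closedBall x r ⊆ Ω := fun w hw => (hball w (hsub hw)).2.2
  have hθr : IntegrableOn θ (Metric.closedBall x r) := hθ.mono_set hsubΩ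
  have hconst : IntegrableOn (fun _ : Euc N => θ x) (Metric.closedBall x r) :=
    integrableOn_const measure_closedBall_lt_top.ne
  have hfint : IntegrableOn (fun w => φ w * massKernel s (u w - u x) * θ w) Ω := by
    refine hθ.bdd_mul (c := M * (s ^ N)⁻¹) ?_ (.of_forall fun p => ?_)
    · exact hφ.aestronglyMeasurable.mul
        ((continuous_massKernel s).measurable.comp_aemeasurable
          (htri.aemeasurable.sub aemeasurable_const)).aestronglyMeasurable
    · rw [norm_mul, Real.norm_eq_abs, Real.norm_eq_abs, abs_of_nonneg (massKernel_nonneg hs.le _)]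
      exact (mul_le_of_le_one_left (massKernel_nonneg hs.le _) (hφ1 _)).trans (hM s hs _)
  have hnonneg : ∀ᵐ w ∂volume.restrict Ω, 0 ≤ φ w * massKernel s (u w - u x) * θ w := by
    filter_upwards [hθ0] with w hw
    exact mul_nonneg (mul_nonneg (hφ0 w) (massKernel_nonneg hs.le _)) hw.le
  have h3 : θ x * V * r ^ N - ∫ w in Metric.closedBall x r, |θ w - θ x| ≤
      ∫ w in Metric.closedBall x r, θ w := by
    have h4 : ∫ w in Metric.closedBall x r, θ x = θ x * V * r ^ N := by
      rw [setIntegral_const, Measure.addHaar_real_closedBall _ _ hr0.le,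
        finrank_euclideanSpace_fin, smul_eq_mul]
      ring
    have habs : IntegrableOn (fun w => |θ w - θ x|) (Metric.closedBall x r) :=
      (hθr.sub hconst).abs
    rw [← h4, ← integral_sub hconst habs]
    refine integral_mono (hconst.sub habs) hθr fun w => ?_
    have := neg_abs_le (θ w - θ x)
    simp only [] at *
    linarith
  have h5 : ∫ w in Metric.closedBall x r, |θ w - θ x| < V * θ x / 2 * r ^ N := by
    rwa [inv_mul_lt_iff₀ (by positivity), mul_comm] at h1
  calc N * ((2 * L) ^ N)⁻¹ * (V * θ x / 2) = (s ^ N)⁻¹ * N * (V * θ x / 2 * r ^ N) := by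
        rw [hrdef, div_pow]
        field_simp
    _ ≤ (s ^ N)⁻¹ * N * ∫ w in Metric.closedBall x r, θ w := by
        gcongr
        nlinarith
    _ = ∫ w in Metric.closedBall x r, φ w * massKernel s (u w - u x) * θ w := by
        rw [← integral_const_mul]
        refine integral_congr_ae ?_
        have hDr := (htri.ae_mem hΩ.measurableSet).filter_mono
          (ae_mono (Measure.restrict_mono hsubΩ le_rfl))
        filter_upwards [hDr, ae_restrict_mem measurableSet_closedBall] with w hwD hw
        obtain ⟨h6, h7, -⟩ := hball w (hsub hw)
        have h8 := h6 hwD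
        rw [h7, massKernel_of_norm_le hs, one_mul]
        refine h8.trans ?_
        rw [mem_closedBall_iff_norm] at hw
        calc L * ‖w - x‖ ≤ L * r := by gcongr
          _ = s / 2 := by rw [hrdef]; field_simp
    _ ≤ ∫ w in Ω, φ w * massKernel s (u w - u x) * θ w :=
        setIntegral_mono_set hfint hnonneg (.of_forall hsubΩ)

end Separation

section AEInjective

variable {N : ℕ} {Ω : Set (Euc N)}

theorem ae_not_eventually_le_integral_bump [IsFiniteMeasure (volume.restrict Ω)] (hN : 2 ≤ N)
    (hΩ : MeasurableSet Ω)
    {us : ℕ → Euc N → Euc N} {D : ℕ → Set (Euc N)} {fs : ℕ → Euc N → Euc N →L[ℝ] Euc N}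
    (hadm : ∀ n, AdmissibleDef Ω (D n) (us n) (fs n))
    (hcof : ∀ n i j, IntegrableOn (fun x => cofCLM (fs n x) i j) Ω)
    {u : Euc N → Euc N} {θ : Euc N → ℝ} (hu : AEMeasurable u (volume.restrict Ω))
    (hθ : IntegrableOn θ Ω) (hθ0 : ∀ᵐ x ∂volume.restrict Ω, 0 < θ x)
    {B : ℝ} (hcB : ∀ i j, ∀ᶠ n in atTop, ∫ x in Ω, |cofCLM (fs n x) i j| ≤ B)
    (hdB : ∀ᶠ n in atTop, ∫ x in Ω, |(fs n x).det| ≤ B)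
    (hdet : WeakL1ConvOn Ω (fun n x => (fs n x).det) θ)
    (hae : ∀ᵐ x ∂(volume.restrict Ω), Tendsto (fun n => us n x) atTop (𝓝 (u x)))
    {S : ℝ} (hS : ∀ n η, TestFun Ω η → SEta Ω (us n) (fs n) η ≤ S)
    {q : Euc N} (φ : ContDiffBump q) (hφ : Metric.closedBall q φ.rOut ⊆ Ω) :
    ∀ᵐ z ∂volume.restrict (Ω \ Metric.closedBall q φ.rOut), ∀ c : ℝ, 0 < c →
      ¬ ∀ᶠ s in 𝓝[>] (0 : ℝ), c ≤ ∫ x in Ω, φ x * massKernel s (u x - u z) * θ x := by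
  obtain ⟨K, hK, hle⟩ := AdmissibleDef.exists_abs_integral_massKernel_le hN
  have hφd : ContDiff ℝ (⊤ : ℕ∞) φ := φ.contDiff
  have hφ1 : ∀ x, |φ x| ≤ 1 := fun x => by rw [abs_of_nonneg φ.nonneg]; exact φ.le_one
  obtain ⟨C, hC⟩ := (φ.hasCompactSupport.fderiv ℝ).exists_bound_of_continuous
    (hφd.continuous_fderiv (by simp))
  have hC0 : 0 ≤ C := (norm_nonneg _).trans (hC q)
  have hCj : ∀ x j, |fderiv ℝ φ x (EuclideanSpace.single j 1)| ≤ C := fun x j => by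
    have h1 := (fderiv ℝ φ x).le_opNorm (EuclideanSpace.single j (1 : ℝ))
    have h2 : ‖EuclideanSpace.single j (1 : ℝ)‖ = 1 := by simp
    rw [h2, mul_one] at h1
    exact h1.trans (hC x)
  have hA : MeasurableSet (Ω \ Metric.closedBall q φ.rOut) := hΩ.diff measurableSet_closedBall
  refine ae_not_eventually_le_integral_massKernel hu hθ hθ0 φ.continuous (fun x => φ.nonneg) hφ1
    sdiff_subset (B := K * (S + C * ∑ _i : Fin N, ∑ _j : Fin N, B)) fun s hs => ?_
  refine le_of_tendsto (tendsto_integral_massKernel hadm hdB hdet hae φ.continuous hφ1 hA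
    sdiff_subset hs).abs ?_
  have hcB' : ∀ᶠ n in atTop, ∀ i j, ∫ x in Ω, |cofCLM (fs n x) i j| ≤ B :=
    eventually_all.2 fun i => eventually_all.2 fun j => hcB i j
  filter_upwards [hcB'] with n hn
  refine (hle (hadm n) hΩ (hcof n) (hS n) hφd φ.hasCompactSupport (by rwa [φ.tsupport_eq]) hφ1 hCj
    hA sdiff_subset (fun x hx => ?_) hs).trans ?_
  · refine φ.zero_of_le_dist ?_
    have := hx.2
    rw [Metric.mem_closedBall, not_le] at this
    exact this.le
  · rw [mul_right_comm]
    gcongr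
    exact hn _ _

theorem exists_ae_mem_injOn [IsFiniteMeasure (volume.restrict Ω)] (hN : 2 ≤ N) (hΩ : IsOpen Ω)
    {us : ℕ → Euc N → Euc N} {D : ℕ → Set (Euc N)} {fs : ℕ → Euc N → Euc N →L[ℝ] Euc N}
    (hadm : ∀ n, AdmissibleDef Ω (D n) (us n) (fs n))
    (hcof : ∀ n i j, IntegrableOn (fun x => cofCLM (fs n x) i j) Ω)
    {u : Euc N → Euc N} {D₀ : Set (Euc N)} {f₀ : Euc N → Euc N →L[ℝ] Euc N}
    (htri : ApproxDiffTriple Ω D₀ u f₀) {θ : Euc N → ℝ}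
    (hθ : IntegrableOn θ Ω) (hθ0 : ∀ᵐ x ∂volume.restrict Ω, 0 < θ x)
    {B : ℝ} (hcB : ∀ i j, ∀ᶠ n in atTop, ∫ x in Ω, |cofCLM (fs n x) i j| ≤ B)
    (hdB : ∀ᶠ n in atTop, ∫ x in Ω, |(fs n x).det| ≤ B)
    (hdet : WeakL1ConvOn Ω (fun n x => (fs n x).det) θ)
    (hae : ∀ᵐ x ∂(volume.restrict Ω), Tendsto (fun n => us n x) atTop (𝓝 (u x)))
    {S : ℝ} (hS : ∀ n η, TestFun Ω η → SEta Ω (us n) (fs n) η ≤ S) :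
    ∃ G : Set (Euc N), (∀ᵐ x ∂volume.restrict Ω, x ∈ G) ∧ InjOn u G := by
  have : Nonempty (Euc N) := ⟨0⟩
  let q : ℕ → Euc N := TopologicalSpace.denseSeq (Euc N)
  let φ : ∀ k m : ℕ, ContDiffBump (q k) := fun k m =>
    ⟨1 / ((m : ℝ) + 1), 2 * (1 / ((m : ℝ) + 1)), by positivity,
      lt_two_mul_self (by positivity)⟩
  let G : Set (Euc N) := {x | x ∈ Ω ∧ x ∈ D₀ ∧ 0 < θ x ∧
    Tendsto (fun r : ℝ => (r ^ N)⁻¹ * ∫ w in Metric.closedBall x r, |θ w - θ x|) (𝓝[>] 0) (𝓝 0) ∧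
    ∀ k m, Metric.closedBall (q k) (φ k m).rOut ⊆ Ω → x ∉ Metric.closedBall (q k) (φ k m).rOut →
      ∀ c : ℝ, 0 < c →
      ¬ ∀ᶠ s in 𝓝[>] (0 : ℝ), c ≤ ∫ w in Ω, φ k m w * massKernel s (u w - u x) * θ w}
  refine ⟨G, ?_, fun x hx z hz hxz => ?_⟩
  · have h1 : ∀ᵐ x ∂volume.restrict Ω, ∀ k m, Metric.closedBall (q k) (φ k m).rOut ⊆ Ω →
        x ∉ Metric.closedBall (q k) (φ k m).rOut → ∀ c : ℝ, 0 < c →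
        ¬ ∀ᶠ s in 𝓝[>] (0 : ℝ), c ≤ ∫ w in Ω, φ k m w * massKernel s (u w - u x) * θ w := by
      rw [ae_all_iff]
      intro k
      rw [ae_all_iff]
      intro m
      by_cases h : Metric.closedBall (q k) (φ k m).rOut ⊆ Ω
      · have h2 := ae_not_eventually_le_integral_bump hN hΩ.measurableSet hadm hcof
          htri.aemeasurable hθ hθ0 hcB hdB hdet hae hS (φ k m) h
        rw [ae_restrict_iff' (hΩ.measurableSet.diff measurableSet_closedBall)] at h2
        filter_upwards [ae_restrict_of_ae h2, ae_restrict_mem hΩ.measurableSet] with x hx hxΩ _ hxb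
        exact hx ⟨hxΩ, hxb⟩
      · exact .of_forall fun x h' => absurd h' h
    filter_upwards [ae_restrict_mem hΩ.measurableSet, htri.ae_mem hΩ.measurableSet, hθ0,
      ae_tendsto_integral_closedBall_abs_sub hΩ hθ, h1] with x h1 h2 h3 h4 h5
    exact ⟨h1, h2, h3, h4, h5⟩
  · by_contra hne
    obtain ⟨hxΩ, hxD, hx0, hxL, -⟩ := hx
    obtain ⟨ρ, hρ, hρΩ⟩ := Metric.isOpen_iff.1 hΩ x hxΩ
    obtain ⟨m, hm⟩ := exists_nat_one_div_lt
      (show 0 < min ρ (dist z x) / 3 from div_pos (lt_min hρ (dist_pos.2 (Ne.symm hne))) three_pos)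
    set r := 1 / ((m : ℝ) + 1) with hr
    have hr0 : 0 < r := by positivity
    obtain ⟨_, hk, ⟨k, rfl⟩⟩ :=
      Metric.dense_iff.1 (TopologicalSpace.denseRange_denseSeq (Euc N)) x r hr0
    have hk' : dist (q k) x < r := hk
    have hmρ : 3 * r < ρ := by linarith [min_le_left ρ (dist z x)]
    have hmz : 3 * r < dist z x := by linarith [min_le_right ρ (dist z x)]
    have hrin : (φ k m).rIn = r := rfl
    have hrout : (φ k m).rOut = 2 * r := rfl
    obtain ⟨c, hc, hev⟩ := exists_eventually_le_integral_massKernel (by omega) hΩ htri hθ hθ0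
      (φ k m).continuous (fun w => (φ k m).nonneg)
      (fun w => by rw [abs_of_nonneg (φ k m).nonneg]; exact (φ k m).le_one) hxD hx0 hxL
      ((φ k m).eventuallyEq_one_of_mem_ball (by rw [hrin, Metric.mem_ball, dist_comm]; exact hk'))
    rw [hxz] at hev
    refine hz.2.2.2.2 k m (fun w hw => hρΩ ?_) (fun hw => ?_) c hc hev
    · rw [hrout, Metric.mem_closedBall] at hw
      rw [Metric.mem_ball]
      linarith [dist_triangle w (q k) x]
    · rw [hrout, Metric.mem_closedBall] at hw
      linarith [dist_triangle z (q k) x]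

end AEInjective

/-- Weak continuity of the Jacobian determinant, a.e. injectivity of the limit, and lower
semicontinuity of the surface energy under a uniform surface-energy bound
(Theorem of Henao and Mora-Corral). -/
theorem weak_continuity_det_inj_and_lsc_surface_energy {N : ℕ} (hN : 2 ≤ N)
    (Ω : Set (Euc N)) (hΩo : IsOpen Ω) (hΩb : Bornology.IsBounded Ω)
    (y : ℕ → Euc N → Euc N) (D : ℕ → Set (Euc N)) (f : ℕ → Euc N → Euc N →L[ℝ] Euc N)
    (hadm : ∀ n, AdmissibleDef Ω (D n) (y n) (f n))
    (hcofint : ∀ n, ∀ i j, IntegrableOn (fun x => cofCLM (f n x) i j) Ω volume)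
    (y₀ : Euc N → Euc N) (D₀ : Set (Euc N)) (f₀ : Euc N → Euc N →L[ℝ] Euc N)
    (htri₀ : ApproxDiffTriple Ω D₀ y₀ f₀)
    (hcofint₀ : ∀ i j, IntegrableOn (fun x => cofCLM (f₀ x) i j) Ω volume)
    (h : Euc N → ℝ) (hhint : IntegrableOn h Ω volume)
    (hhpos : ∀ᵐ x ∂(volume.restrict Ω), 0 < h x)
    (hae : ∀ᵐ x ∂(volume.restrict Ω), Tendsto (fun n => y n x) atTop (𝓝 (y₀ x)))
    (hcof : ∀ i j, WeakL1ConvOn Ω (fun n x => cofCLM (f n x) i j) (fun x => cofCLM (f₀ x) i j))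
    (hdet : WeakL1ConvOn Ω (fun n x => (f n x).det) h)
    (hS : (⨆ n, surfaceEnergy Ω (y n) (f n)) < ⊤) :
    (∀ᵐ x ∂(volume.restrict Ω), h x = (f₀ x).det) ∧
    (∃ Z : Set (Euc N), Z ⊆ Ω ∧ volume Z = 0 ∧ Set.InjOn y₀ (Ω \ Z) ∧
      AdmissibleDef Ω (D₀ ∩ (Ω \ Z)) y₀ f₀) ∧
    surfaceEnergy Ω y₀ f₀ ≤ atTop.liminf (fun n => surfaceEnergy Ω (y n) (f n)) := by
  have : NeZero N := ⟨by omega⟩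
  have : IsFiniteMeasure (volume.restrict Ω) :=
    isFiniteMeasure_restrict.2 hΩb.measure_lt_top.ne
  have hΩm : MeasurableSet Ω := hΩo.measurableSet
  set S : ℝ := (⨆ n, surfaceEnergy Ω (y n) (f n)).toReal with hS_def
  have hSle : ∀ n η, TestFun Ω η → SEta Ω (y n) (f n) η ≤ S := fun n η hη => by
    refine (ENNReal.ofReal_le_iff_le_toReal hS.ne).1 ?_
    exact (le_iSup (fun η : {η : Euc N × Euc N → Euc N // TestFun Ω η} =>
      ENNReal.ofReal (SEta Ω (y n) (f n) η.1)) ⟨η, hη⟩).trans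
      (le_iSup (fun n => surfaceEnergy Ω (y n) (f n)) n)
  choose Bc hBc using fun i j =>
    exists_eventually_integral_abs_le_of_weak hΩm hΩb (fun n => hcofint n i j) (hcof i j)
  obtain ⟨Bd, hBd⟩ :=
    exists_eventually_integral_abs_le_of_weak hΩm hΩb (fun n => (hadm n).2.2.2) hdet
  obtain ⟨B, hcB, hdB⟩ : ∃ B, (∀ i j, ∀ᶠ n in atTop, ∫ x in Ω, |cofCLM (f n x) i j| ≤ B) ∧
      ∀ᶠ n in atTop, ∫ x in Ω, |(f n x).det| ≤ B := by
    obtain ⟨M, hM⟩ := (Set.finite_range fun p : Fin N × Fin N => Bc p.1 p.2).bddAbove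
    exact ⟨max M Bd, fun i j => (hBc i j).mono fun n hn =>
        (hn.trans (hM ⟨(i, j), rfl⟩)).trans (le_max_left _ _),
      hBd.mono fun n hn => hn.trans (le_max_right _ _)⟩
  have hlim : ∀ η, TestFun Ω η → Tendsto (fun n => SEta Ω (y n) (f n) η) atTop
      (𝓝 (energyFunctional Ω y₀ (fun x => cofCLM (f₀ x)) h η)) := fun η hη =>
    tendsto_energyFunctional hη.1 hη.2.1 (fun n => (hadm n).1.aemeasurable) hcofint
      (fun n => (hadm n).2.2.2) htri₀.aemeasurable hcofint₀ hhint hcB hdB hcof hdet hae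
  have hdet₀ : ∀ᵐ x ∂volume.restrict Ω, h x = (f₀ x).det :=
    ae_eq_det_of_energyFunctional_le hΩo (by omega) htri₀ hcofint₀ hhint fun η hη =>
      le_of_tendsto' (hlim η hη) fun n => hSle n η hη
  refine ⟨hdet₀, ?_, ?_⟩
  · obtain ⟨G, hG, hinj⟩ := exists_ae_mem_injOn hN hΩo hadm hcofint htri₀ hhint hhpos hcB hdB hdet
      hae hSle
    have hgood : ∀ᵐ x ∂volume, x ∈ Ω → x ∈ G ∧ 0 < (f₀ x).det := by
      rw [← ae_restrict_iff' hΩm]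
      filter_upwards [hG, hhpos, hdet₀] with x h1 h2 h3
      exact ⟨h1, h3 ▸ h2⟩
    obtain ⟨T, hT, hTm, hT0⟩ := exists_measurable_superset_of_null (ae_iff.1 hgood)
    have hmem : ∀ x ∈ Ω \ (Ω ∩ T), x ∈ G ∧ 0 < (f₀ x).det := fun x hx => by
      by_contra hcon
      exact hx.2 ⟨hx.1, hT fun hx' => hcon (hx' hx.1)⟩
    have hinjΩ : InjOn y₀ (Ω \ (Ω ∩ T)) := hinj.mono fun x hx => (hmem x hx).1
    have hZ0 : volume (Ω ∩ T) = 0 := measure_mono_null inter_subset_right hT0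
    refine ⟨Ω ∩ T, inter_subset_left, hZ0, hinjΩ, ⟨?_, ?_, ?_, ?_⟩,
      hinjΩ.mono inter_subset_right, fun x hx => (hmem x hx.2).2, hhint.congr hdet₀⟩
    · exact htri₀.1.inter (hΩm.diff (hΩm.inter hTm))
    · exact inter_subset_left.trans htri₀.2.1
    · refine measure_mono_null (t := (Ω \ D₀) ∪ Ω ∩ T) (fun x hx => ?_)
        (measure_union_null htri₀.2.2.1 hZ0)
      by_cases hxD : x ∈ D₀
      · by_contra hcon
        exact hx.2 ⟨hxD, hx.1, fun hxT => hcon (.inr hxT)⟩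
      · exact .inl ⟨hx.1, hxD⟩
    · exact fun x hx => (htri₀.2.2.2 x hx.1).mono inter_subset_left
  · refine iSup_le fun η => ?_
    have heq : SEta Ω y₀ f₀ η.1 = energyFunctional Ω y₀ (fun x => cofCLM (f₀ x)) h η.1 := by
      refine integral_congr_ae ?_
      filter_upwards [hdet₀] with x hx
      rw [hx]
    rw [heq, ← ((ENNReal.continuous_ofReal.tendsto _).comp (hlim η.1 η.2)).liminf_eq]
    exact liminf_le_liminf (.of_forall fun n =>
      le_iSup (fun η : {η : Euc N × Euc N → Euc N // TestFun Ω η} =>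
        ENNReal.ofReal (SEta Ω (y n) (f n) η.1)) η)
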